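/- arXiv:math/0008075 — 13 statements merged into one kernel-verified Lean document; each statement's English description precedes it below -/
import Mathlib

section
/- Let a : ℤ → ℂ be a sequence with a_{-n} = a_n for all n ∈ ℤ, and for n ≥ 1 define b_n = Σ_{k=0}^{n-1} C(n-1,k)·(a_{1-n+2k} + a_{2-n+2k}). For N ≥ 1 let A_N be the N×N matrix with entries (A_N)_{j,k} = a_{j-k} + a_{j+k+1} (0 ≤ j,k ≤ N-1), let B_N be the N×N matrix with entries (B_N)_{j,k} = b_{j+k+1}, and let D_N be the upper triangular N×N matrix with entries (D_N)_{j,k} = C(k, ⌊(k-j)/2⌋) for j ≤ k and (D_N)_{j,k} = 0 for j > k. Then B_N = D_N^T · A_N · D_N. -/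
open Finset

/-- The operator `f ↦ (x ↦ f (x + 1) + f (x - 1))` on two-sided sequences. -/
def shiftSum (f : ℤ → ℂ) : ℤ → ℂ := fun x => f (x + 1) + f (x - 1)

/-- The entry `(m, k)` of the upper triangular matrix `D`. -/
def triangularEntry (k m : ℕ) : ℂ :=
  if m ≤ k then (k.choose ((k - m) / 2) : ℂ) else 0

lemma triangularEntry_of_lt {k m : ℕ} (h : k < m) : triangularEntry k m = 0 := by
  simp [triangularEntry, h]

lemma triangularEntry_succ_zero (k : ℕ) :
    triangularEntry (k + 1) 0 = triangularEntry k 0 + triangularEntry k 1 := by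
  rcases Nat.even_or_odd' k with ⟨r, rfl | rfl⟩
  · rcases r with _ | r
    · simp [triangularEntry]
    · have h₁ : (2 * (r + 1) + 1 - 0) / 2 = r + 1 := by lia
      have h₂ : (2 * (r + 1) - 0) / 2 = r + 1 := by lia
      have h₃ : (2 * (r + 1) - 1) / 2 = r := by lia
      have h₄ : 1 ≤ 2 * (r + 1) := by lia
      simp only [triangularEntry, h₁, h₂, h₃, h₄, Nat.zero_le, if_true, Nat.choose_succ_succ]
      push_cast
      ring
  · have h₁ : (2 * r + 1 + 1 - 0) / 2 = r + 1 := by lia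
    have h₂ : (2 * r + 1 - 0) / 2 = r := by lia
    have h₃ : (2 * r + 1 - 1) / 2 = r := by lia
    have h₄ : 1 ≤ 2 * r + 1 := by lia
    simp only [triangularEntry, h₁, h₂, h₃, h₄, Nat.zero_le, if_true]
    rw [Nat.choose_succ_succ (2 * r + 1) r, Nat.choose_symm_half]
    push_cast
    ring

lemma triangularEntry_succ_succ (k m : ℕ) :
    triangularEntry (k + 1) (m + 1) = triangularEntry k m + triangularEntry k (m + 2) := by
  rcases lt_or_ge k m with h | h
  · simp [triangularEntry_of_lt, h, Nat.lt_add_right]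
  obtain ⟨r, rfl⟩ := Nat.exists_eq_add_of_le h
  rcases r with _ | _ | r
  · simp [triangularEntry]
  · simp [triangularEntry]
  · have h₁ : (m + (r + 1 + 1) + 1 - (m + 1)) / 2 = r / 2 + 1 := by lia
    have h₂ : (m + (r + 1 + 1) - m) / 2 = r / 2 + 1 := by lia
    have h₃ : (m + (r + 1 + 1) - (m + 2)) / 2 = r / 2 := by lia
    have h₄ : m + 1 ≤ m + (r + 1 + 1) + 1 := by lia
    have h₅ : m ≤ m + (r + 1 + 1) := by lia
    have h₆ : m + 2 ≤ m + (r + 1 + 1) := by lia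
    simp only [triangularEntry, h₁, h₂, h₃, h₄, h₅, h₆, if_true]
    rw [Nat.choose_succ_succ (m + (r + 1 + 1)) (r / 2)]
    push_cast
    ring

/-- Pairing a column of `D` with a sequence symmetric about `-1/2` evaluates an iterate of
`shiftSum` at `0`. -/
lemma sum_triangularEntry_mul (k N : ℕ) (hk : k < N) (g : ℤ → ℂ) (hg : ∀ m, g (-1 - m) = g m) :
    ∑ m ∈ range N, triangularEntry k m * g m = shiftSum^[k] g 0 := by
  induction k generalizing N g with
  | zero =>
    rw [sum_eq_single_of_mem 0 (by simpa using hk)]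
    · simp [triangularEntry]
    · intro m _ hm
      rw [triangularEntry_of_lt (Nat.pos_of_ne_zero hm), zero_mul]
  | succ k ih =>
    obtain ⟨M, rfl⟩ : ∃ M, N = M + 1 := ⟨N - 1, by lia⟩
    have hM : k < M := by lia
    have hsymm : ∀ m, shiftSum g (-1 - m) = shiftSum g m := by
      intro m
      have h₁ : g (-1 - m + 1) = g (m - 1) := by rw [← hg]; congr 1; ring
      have h₂ : g (-1 - m - 1) = g (m + 1) := by rw [← hg]; congr 1; ring
      rw [shiftSum, shiftSum, h₁, h₂, add_comm]
    rw [Function.iterate_succ_apply, ← ih (M + 1) (by lia) _ hsymm]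
    have hleft := sum_range_succ' (fun m : ℕ => triangularEntry k (m + 1) * g m) M
    rw [sum_range_succ, triangularEntry_of_lt (show k < M + 1 by lia)] at hleft
    have hright := sum_range_succ' (fun m : ℕ => triangularEntry k m * g ((m : ℤ) - 1)) M
    have htop := sum_range_succ (fun m : ℕ => triangularEntry k m * g ((m : ℤ) + 1)) M
    rw [triangularEntry_of_lt hM] at htop
    have h₀ : g (-1) = g 0 := by simpa using hg 0
    rw [sum_range_succ']
    simp only [shiftSum, mul_add, sum_add_distrib, triangularEntry_succ_zero,
      triangularEntry_succ_succ, add_mul]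
    rw [hright, htop]
    push_cast at hleft ⊢
    simp only [add_sub_cancel_right, h₀] at hleft ⊢
    linear_combination -hleft

lemma iterate_shiftSum_apply (n : ℕ) (f : ℤ → ℂ) (x : ℤ) :
    shiftSum^[n] f x = ∑ i ∈ range (n + 1), (n.choose i : ℂ) * f (x - n + 2 * i) := by
  induction n generalizing x with
  | zero => simp
  | succ n ih =>
    rw [Function.iterate_succ_apply', shiftSum, ih, ih,
      sum_choose_succ_mul (fun i _ => f (x - (n + 1 : ℕ) + 2 * i)) n, add_comm]
    congr 1 <;> refine sum_congr rfl fun i _ => ?_ <;> congr 2 <;> push_cast <;> ring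

lemma iterate_shiftSum_add (n : ℕ) (f g : ℤ → ℂ) (x : ℤ) :
    shiftSum^[n] (fun y => f y + g y) x = shiftSum^[n] f x + shiftSum^[n] g x := by
  simp only [iterate_shiftSum_apply, mul_add, sum_add_distrib]

lemma iterate_shiftSum_comp_add (n : ℕ) (f : ℤ → ℂ) (c x : ℤ) :
    shiftSum^[n] (fun y => f (c + y)) x = shiftSum^[n] f (c + x) := by
  simp only [iterate_shiftSum_apply]
  refine sum_congr rfl fun i _ => ?_
  congr 2
  ring

lemma iterate_shiftSum_even (n : ℕ) {f : ℤ → ℂ} (hf : ∀ x, f (-x) = f x) (x : ℤ) :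
    shiftSum^[n] f (-x) = shiftSum^[n] f x := by
  induction n generalizing x with
  | zero => exact hf x
  | succ n ih =>
    simp only [Function.iterate_succ_apply', shiftSum]
    rw [← ih (x + 1), ← ih (x - 1), add_comm]
    congr 2 <;> ring_nf

lemma sum_triangularEntry_mul_symm (k N : ℕ) (hk : k < N) {f : ℤ → ℂ} (hf : ∀ x, f (-x) = f x)
    (l : ℤ) :
    ∑ m ∈ range N, triangularEntry k m * (f (l - m) + f (l + m + 1)) =
      shiftSum^[k] f l + shiftSum^[k] f (l + 1) := by
  rw [sum_triangularEntry_mul k N hk (fun m => f (l - m) + f (l + m + 1))]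
  · have h : (fun m : ℤ => f (l - m) + f (l + m + 1)) =
        fun m => f (-l + m) + f (l + 1 + m) := by
      funext m
      rw [← hf (l - m)]
      congr 2 <;> ring
    rw [h, iterate_shiftSum_add, iterate_shiftSum_comp_add k f, iterate_shiftSum_comp_add k f,
      add_zero, add_zero, iterate_shiftSum_even k hf]
  · intro m
    rw [add_comm]
    congr 2 <;> ring

/-- Let `a : ℤ → ℂ` satisfy `a (-n) = a n`, and for `n ≥ 1` let
`b n = ∑_{k=0}^{n-1} C(n-1,k) (a (1-n+2k) + a (2-n+2k))`.  For `N ≥ 1` let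
`A = (a (j-k) + a (j+k+1))`, `B = (b (j+k+1))`, and let `D` be the upper triangular
matrix with `D j k = C(k, ⌊(k-j)/2⌋)` for `j ≤ k` and `0` otherwise.
Then `B = Dᵀ * A * D`. -/
theorem statement0 (a : ℤ → ℂ) (ha : ∀ n : ℤ, a (-n) = a n)
    (b : ℕ → ℂ)
    (hb : ∀ n : ℕ, 1 ≤ n →
      b n = ∑ k ∈ Finset.range n,
        ((n - 1).choose k : ℂ) * (a (1 - (n : ℤ) + 2 * k) + a (2 - (n : ℤ) + 2 * k)))
    (N : ℕ) (hN : 1 ≤ N)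
    (A B D : Matrix (Fin N) (Fin N) ℂ)
    (hA : ∀ j k : Fin N, A j k = a ((j : ℤ) - (k : ℤ)) + a ((j : ℤ) + (k : ℤ) + 1))
    (hB : ∀ j k : Fin N, B j k = b ((j : ℕ) + (k : ℕ) + 1))
    (hD : ∀ j k : Fin N,
      D j k = if (j : ℕ) ≤ (k : ℕ) then ((k : ℕ).choose (((k : ℕ) - (j : ℕ)) / 2) : ℂ) else 0) :
    B = D.transpose * A * D := by
  have hDentry : ∀ j k : Fin N, D j k = triangularEntry k j := fun j k => by
    rw [hD, triangularEntry]
  ext j k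
  have hinner : ∀ l : Fin N, (A * D) l k =
      shiftSum^[k] a l + shiftSum^[k] a (l + 1) := by
    intro l
    rw [Matrix.mul_apply, ← sum_triangularEntry_mul_symm k N k.isLt ha,
      ← Fin.sum_univ_eq_sum_range
        (fun m : ℕ => triangularEntry k m * (a ((l : ℤ) - m) + a ((l : ℤ) + m + 1)))]
    exact sum_congr rfl fun m _ => by rw [hA, hDentry, mul_comm]
  have hsymm : ∀ m : ℤ, shiftSum^[k] a (-1 - m) + shiftSum^[k] a (-1 - m + 1) =
      shiftSum^[k] a m + shiftSum^[k] a (m + 1) := by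
    intro m
    rw [← iterate_shiftSum_even k ha m, ← iterate_shiftSum_even k ha (m + 1), add_comm]
    congr 2 <;> ring_nf
  have hshift := iterate_shiftSum_comp_add j (shiftSum^[k] a) 1 0
  simp only [add_comm (1 : ℤ)] at hshift
  rw [Matrix.mul_assoc, Matrix.mul_apply, hB, hb _ (Nat.le_add_left 1 _)]
  simp only [hinner, Matrix.transpose_apply, hDentry]
  rw [Fin.sum_univ_eq_sum_range
      (fun m : ℕ => triangularEntry j m * (shiftSum^[k] a m + shiftSum^[k] a ((m : ℤ) + 1))),
    sum_triangularEntry_mul j N j.isLt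
      (fun m => shiftSum^[k] a m + shiftSum^[k] a (m + 1)) hsymm,
    iterate_shiftSum_add, hshift, ← Function.iterate_add_apply,
    iterate_shiftSum_apply, iterate_shiftSum_apply, ← sum_add_distrib]
  refine sum_congr rfl fun i _ => ?_
  rw [← mul_add, Nat.add_sub_cancel]
  congr 3 <;> push_cast <;> ring
end

section
/- For all natural numbers n, m, s with 0 ≤ s ≤ n+m+1, the following binomial identity holds: Σ_{j=0}^{n+m+1-s} C(n, ⌊j/2⌋)·C(m, ⌊(n+m+1-s-j)/2⌋) = C(n+m, ⌊(n+m+s)/2⌋) + C(n+m, ⌊(n+m-s)/2⌋). -/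
open Finset

/-- Binomial coefficient `C(n,k)` with an integer lower index, equal to `0` for `k < 0`. -/
def chooseInt (n : ℕ) (k : ℤ) : ℕ := if 0 ≤ k then n.choose k.toNat else 0

theorem sum_range_two_mul_eq {M : Type*} [AddCommMonoid M] (f : ℕ → M) (k : ℕ) :
    ∑ j ∈ Finset.range (2 * k), f j =
      ∑ i ∈ Finset.range k, f (2 * i) + ∑ i ∈ Finset.range k, f (2 * i + 1) := by
  induction k with
  | zero => simp
  | succ k ih =>
    rw [show 2 * (k + 1) = 2 * k + 1 + 1 by ring, Finset.sum_range_succ, Finset.sum_range_succ, ih,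
      Finset.sum_range_succ, Finset.sum_range_succ]
    abel

theorem sum_range_choose_mul_choose (n m k : ℕ) :
    ∑ i ∈ Finset.range (k + 1), n.choose i * m.choose (k - i) = (n + m).choose k := by
  rw [Nat.add_choose_eq,
    Finset.Nat.sum_antidiagonal_eq_sum_range_succ (fun i j => n.choose i * m.choose j)]

theorem sum_choose_half_mul_choose_half_odd (n m k : ℕ) :
    ∑ j ∈ Finset.range (2 * k + 1 + 1), n.choose (j / 2) * m.choose ((2 * k + 1 - j) / 2) =
      (n + m).choose k + (n + m).choose k := by
  rw [show 2 * k + 1 + 1 = 2 * (k + 1) by ring, sum_range_two_mul_eq]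
  simp only [← sum_range_choose_mul_choose]
  congr 1 <;>
  · refine Finset.sum_congr rfl fun i hi => ?_
    rw [Finset.mem_range] at hi
    congr 2 <;> omega

theorem sum_choose_half_mul_choose_half_even (n m k : ℕ) :
    ∑ j ∈ Finset.range (2 * (k + 1) + 1), n.choose (j / 2) * m.choose ((2 * (k + 1) - j) / 2) =
      (n + m).choose (k + 1) + (n + m).choose k := by
  rw [Finset.sum_range_succ, sum_range_two_mul_eq, add_right_comm]
  simp only [← sum_range_choose_mul_choose]
  rw [Finset.sum_range_succ _ (k + 1)]
  congr 1
  · congr 1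
    · refine Finset.sum_congr rfl fun i hi => ?_
      rw [Finset.mem_range] at hi
      congr 2 <;> omega
    · congr 2 <;> omega
  · refine Finset.sum_congr rfl fun i hi => ?_
    rw [Finset.mem_range] at hi
    congr 2 <;> omega

/-- For all naturals `n, m, s` with `s ≤ n + m + 1`:
`∑_{j=0}^{n+m+1-s} C(n, ⌊j/2⌋) C(m, ⌊(n+m+1-s-j)/2⌋)
  = C(n+m, ⌊(n+m+s)/2⌋) + C(n+m, ⌊(n+m-s)/2⌋)`,
where binomial coefficients with negative lower index are `0`. -/
theorem statement1 (n m s : ℕ) (hs : s ≤ n + m + 1) :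
    ∑ j ∈ Finset.range (n + m + 1 - s + 1),
        n.choose (j / 2) * m.choose ((n + m + 1 - s - j) / 2)
      = (n + m).choose ((n + m + s) / 2) + chooseInt (n + m) (((n : ℤ) + m - s) / 2) := by
  obtain ⟨K, hK⟩ : ∃ K, K = n + m + 1 - s := ⟨_, rfl⟩
  rw [← hK]
  obtain ⟨k, rfl | rfl⟩ := K.even_or_odd'
  · cases k with
    | zero =>
      have h : ¬ (0 : ℤ) ≤ ((n : ℤ) + m - s) / 2 := by omega
      rw [chooseInt, if_neg h, show (n + m + s) / 2 = n + m by omega]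
      simp
    | succ k =>
      have h : ((n : ℤ) + m - s) / 2 = k := by omega
      rw [sum_choose_half_mul_choose_half_even, h, chooseInt, if_pos (Int.natCast_nonneg k),
        Int.toNat_natCast, show (n + m + s) / 2 = n + m - (k + 1) by omega,
        Nat.choose_symm (by omega)]
  · have h : ((n : ℤ) + m - s) / 2 = k := by omega
    rw [sum_choose_half_mul_choose_half_odd, h, chooseInt, if_pos (Int.natCast_nonneg k),
      Int.toNat_natCast, show (n + m + s) / 2 = n + m - k by omega, Nat.choose_symm (by omega)]
end

section
/- Let a : ℤ → ℂ be a sequence with a_{-n} = a_n for all n ∈ ℤ, and for n ≥ 1 define b_n = Σ_{k=0}^{n-1} C(n-1,k)·(a_{1-n+2k} + a_{2-n+2k}). For N ≥ 1 let A_N = (a_{j-k} + a_{j+k+1})_{j,k=0}^{N-1} and B_N = (b_{j+k+1})_{j,k=0}^{N-1}. Then det A_N = det B_N. -/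
open Finset

section

open Polynomial LaurentPolynomial

/-- The Gram matrix of a linear functional on polynomials has the same determinant in any
basis of monic polynomials `p j` of degree `j` as in the monomial basis. -/
theorem det_gram_monic_eq_det_hankel {R : Type*} [CommRing R] (M : R[X] →ₗ[R] R) (p : ℕ → R[X])
    (hmonic : ∀ j, (p j).Monic) (hdeg : ∀ j, (p j).natDegree = j) (N : ℕ) :
    Matrix.det (Matrix.of fun j k : Fin N => M (p j * p k))
      = Matrix.det (Matrix.of fun j k : Fin N => M (X ^ ((j : ℕ) + (k : ℕ)))) := by
  set P : Matrix (Fin N) (Fin N) R := Matrix.of fun j k => (p j).coeff k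
  have hP : P.det = 1 := by
    rw [Matrix.det_of_isLowerTriangular]
    · refine Finset.prod_eq_one fun i _ => ?_
      have h := hmonic i
      rwa [Monic, leadingCoeff, hdeg] at h
    · intro i j hij
      refine coeff_eq_zero_of_natDegree_lt ?_
      rw [hdeg]
      exact hij
  have hsum (j : Fin N) : p j = ∑ l : Fin N, P j l • X ^ (l : ℕ) := by
    conv_lhs => rw [(p j).as_sum_range_C_mul_X_pow' ((hdeg j).trans_lt j.isLt),
      Finset.sum_range]
    simp [P, Polynomial.smul_eq_C_mul]
  have hfac : (Matrix.of fun j k : Fin N => M (p j * p k))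
      = P * (Matrix.of fun j k : Fin N => M (X ^ ((j : ℕ) + (k : ℕ)))) * P.transpose := by
    ext j k
    rw [Matrix.of_apply, hsum j, hsum k]
    simp only [Finset.mul_sum, Finset.sum_mul, map_sum, Matrix.mul_apply, Matrix.of_apply,
      Matrix.transpose_apply, smul_mul_smul_comm, ← pow_add, map_smul, smul_eq_mul]
    exact Finset.sum_congr rfl fun _ _ => Finset.sum_congr rfl fun _ _ => by ring
  rw [hfac, Matrix.det_mul, Matrix.det_mul, Matrix.det_transpose, hP, one_mul, mul_one]

/-- The Chebyshev polynomials of the third kind, rescaled to be monic. -/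
noncomputable def monicChebyshevV (R : Type*) [CommRing R] : ℕ → R[X]
  | 0 => 1
  | 1 => X - 1
  | n + 2 => X * monicChebyshevV R (n + 1) - monicChebyshevV R n

theorem monicChebyshevV_monic_and_natDegree (R : Type*) [CommRing R] [Nontrivial R] (n : ℕ) :
    (monicChebyshevV R n).Monic ∧ (monicChebyshevV R n).natDegree = n := by
  induction n using Nat.twoStepInduction with
  | zero => simp [monicChebyshevV]
  | one => exact ⟨monic_X_sub_C 1, natDegree_X_sub_C 1⟩
  | more n ih₀ ih₁ =>
    have hmon : (X * monicChebyshevV R (n + 1)).Monic := monic_X.mul ih₁.1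
    have hdeg : (X * monicChebyshevV R (n + 1)).natDegree = n + 2 := by
      rw [monic_X.natDegree_mul ih₁.1, natDegree_X, ih₁.2]
      ring
    have hlt : (monicChebyshevV R n).natDegree < (X * monicChebyshevV R (n + 1)).natDegree := by
      omega
    refine ⟨hmon.sub_of_left (degree_lt_degree hlt), ?_⟩
    rw [monicChebyshevV, natDegree_sub_eq_left_of_natDegree_lt hlt, hdeg]

theorem one_add_T_mul_aeval_monicChebyshevV {R : Type*} [CommRing R] (n : ℕ) :
    (1 + T 1) * aeval (T 1 + T (-1) : R[T;T⁻¹]) (monicChebyshevV R n)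
      = T ((n : ℤ) + 1) + T (-(n : ℤ)) := by
  induction n using Nat.twoStepInduction with
  | zero => simp [monicChebyshevV, add_comm]
  | one =>
    have h : (T 1 * T (-1) : R[T;T⁻¹]) = 1 := by rw [← T_add, add_neg_cancel, T_zero]
    simp only [monicChebyshevV, map_sub, aeval_X, map_one, Nat.cast_one, T_add]
    linear_combination h
  | more n ih₀ ih₁ =>
    have h : (T 1 * T (-1) : R[T;T⁻¹]) = 1 := by rw [← T_add, add_neg_cancel, T_zero]
    simp only [monicChebyshevV, map_sub, map_mul, aeval_X]
    push_cast at ih₁ ⊢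
    rw [show (n : ℤ) + 2 + 1 = n + 1 + 1 + 1 by ring, show -((n : ℤ) + 2) = -n + -1 + -1 by ring]
    rw [show -((n : ℤ) + 1) = -n + -1 by ring] at ih₁
    simp only [T_add] at ih₀ ih₁ ⊢
    linear_combination (T 1 + T (-1)) * ih₁ - ih₀ + (T n * T 1 + T (-n)) * h

theorem invert_aeval_T_add_T_neg {R : Type*} [CommRing R] (p : R[X]) :
    invert (aeval (T 1 + T (-1) : R[T;T⁻¹]) p) = aeval (T 1 + T (-1) : R[T;T⁻¹]) p := by
  rw [← AlgEquiv.coe_toAlgHom, ← aeval_algHom_apply]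
  simp [add_comm]

/-- The linear functional on Laurent polynomials with moments `a`. -/
noncomputable def laurentMoment {R : Type*} [CommRing R] (a : ℤ → R) : R[T;T⁻¹] →ₗ[R] R :=
  Finsupp.linearCombination R a ∘ₗ (AddMonoidAlgebra.coeffLinearEquiv R).toLinearMap

@[simp]
theorem laurentMoment_T {R : Type*} [CommRing R] (a : ℤ → R) (n : ℤ) :
    laurentMoment a (T n) = a n := by
  simp [laurentMoment, T, -single_eq_C_mul_T]

theorem laurentMoment_invert {R : Type*} [CommRing R] {a : ℤ → R} (ha : ∀ n, a (-n) = a n)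
    (f : R[T;T⁻¹]) : laurentMoment a (invert f) = laurentMoment a f := by
  induction f using LaurentPolynomial.induction_on' with
  | add p q hp hq => simp [hp, hq]
  | C_mul_T n r => simp [← LaurentPolynomial.smul_eq_C_mul, ha]

/-- The linear functional `p ↦ L ((1 + T) * p (T + T⁻¹))`, where `L` has moments `a`. -/
noncomputable def hankelMoment {R : Type*} [CommRing R] (a : ℤ → R) : R[X] →ₗ[R] R :=
  laurentMoment a ∘ₗ LinearMap.mulLeft R (1 + T 1) ∘ₗ
    (aeval (T 1 + T (-1) : R[T;T⁻¹])).toLinearMap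

theorem hankelMoment_apply {R : Type*} [CommRing R] (a : ℤ → R) (p : R[X]) :
    hankelMoment a p = laurentMoment a ((1 + T 1) * aeval (T 1 + T (-1) : R[T;T⁻¹]) p) :=
  rfl

theorem two_mul_hankelMoment {R : Type*} [CommRing R] {a : ℤ → R} (ha : ∀ n, a (-n) = a n)
    (p : R[X]) :
    2 * hankelMoment a p =
      laurentMoment a ((1 + T 1) * (1 + T (-1)) * aeval (T 1 + T (-1) : R[T;T⁻¹]) p) := by
  have h : (T 1 * T (-1) : R[T;T⁻¹]) = 1 := by rw [← T_add, add_neg_cancel, T_zero]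
  have hinv := laurentMoment_invert ha ((1 + T 1) * aeval (T 1 + T (-1) : R[T;T⁻¹]) p)
  rw [map_mul, invert_aeval_T_add_T_neg, map_add, map_one, invert_T] at hinv
  rw [two_mul]
  nth_rewrite 2 [hankelMoment_apply]
  rw [← hinv, hankelMoment_apply, ← map_add]
  congr 1
  linear_combination -aeval (T 1 + T (-1) : R[T;T⁻¹]) p * h

theorem two_mul_hankelMoment_monicChebyshevV_mul {R : Type*} [CommRing R] {a : ℤ → R}
    (ha : ∀ n, a (-n) = a n) (j k : ℕ) :
    2 * hankelMoment a (monicChebyshevV R j * monicChebyshevV R k)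
      = 2 * (a ((j : ℤ) - k) + a ((j : ℤ) + k + 1)) := by
  have hk := congrArg invert (one_add_T_mul_aeval_monicChebyshevV (R := R) k)
  rw [map_mul, invert_aeval_T_add_T_neg, map_add, map_one, invert_T, map_add, invert_T,
    invert_T, neg_neg] at hk
  rw [two_mul_hankelMoment ha, map_mul (aeval _), mul_mul_mul_comm, one_add_T_mul_aeval_monicChebyshevV, hk]
  simp only [add_mul, mul_add, ← T_add, map_add, laurentMoment_T]
  rw [← ha (-(j : ℤ) + -((k : ℤ) + 1)), ← ha (-(j : ℤ) + k)]
  ring_nf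

theorem hankelMoment_X_pow {R : Type*} [CommRing R] (a : ℤ → R) (n : ℕ) :
    hankelMoment a (X ^ n) = ∑ k ∈ Finset.range (n + 1),
      (n.choose k : R) * (a (-(n : ℤ) + 2 * k) + a (1 - (n : ℤ) + 2 * k)) := by
  rw [hankelMoment_apply, map_pow, aeval_X, add_pow, Finset.mul_sum, map_sum]
  refine Finset.sum_congr rfl fun k hk => ?_
  have hk : k ≤ n := Nat.lt_succ_iff.mp (Finset.mem_range.mp hk)
  have h : (1 + T 1) * (T 1 ^ k * T (-1) ^ (n - k) * (n.choose k : R[T;T⁻¹]))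
      = (n.choose k : R) • (T (-(n : ℤ) + 2 * k) + T (1 - (n : ℤ) + 2 * k)) := by
    rw [T_pow, T_pow, ← T_add, ← mul_assoc, add_mul, one_mul, ← T_add, mul_comm,
      Nat.cast_smul_eq_nsmul, nsmul_eq_mul]
    push_cast [hk]
    ring_nf
  rw [h, map_smul, map_add, laurentMoment_T, laurentMoment_T, smul_eq_mul]

end

/-- With `a` even and `b` as in Statement 0, the determinants of
`A_N = (a (j-k) + a (j+k+1))` and `B_N = (b (j+k+1))` coincide. -/
theorem statement2 (a : ℤ → ℂ) (ha : ∀ n : ℤ, a (-n) = a n)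
    (b : ℕ → ℂ)
    (hb : ∀ n : ℕ, 1 ≤ n →
      b n = ∑ k ∈ Finset.range n,
        ((n - 1).choose k : ℂ) * (a (1 - (n : ℤ) + 2 * k) + a (2 - (n : ℤ) + 2 * k)))
    (N : ℕ) (hN : 1 ≤ N) :
    Matrix.det (Matrix.of fun j k : Fin N =>
        a ((j : ℤ) - (k : ℤ)) + a ((j : ℤ) + (k : ℤ) + 1))
      = Matrix.det (Matrix.of fun j k : Fin N => b ((j : ℕ) + (k : ℕ) + 1)) := by
  have hA (j k : ℕ) : a ((j : ℤ) - k) + a ((j : ℤ) + k + 1)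
      = hankelMoment a (monicChebyshevV ℂ j * monicChebyshevV ℂ k) :=
    (mul_left_cancel₀ two_ne_zero (two_mul_hankelMoment_monicChebyshevV_mul ha j k)).symm
  have hB (n : ℕ) : b (n + 1) = hankelMoment a (Polynomial.X ^ n) := by
    rw [hb (n + 1) n.succ_pos, hankelMoment_X_pow]
    refine Finset.sum_congr rfl fun k _ => ?_
    rw [Nat.add_sub_cancel]
    push_cast
    ring_nf
  simp only [hA, hB]
  exact det_gram_monic_eq_det_hankel _ _
    (fun j => (monicChebyshevV_monic_and_natDegree ℂ j).1)
    (fun j => (monicChebyshevV_monic_and_natDegree ℂ j).2) N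
end

section
/- Let a : ℝ → ℂ be 2π-periodic, integrable on [-π,π], and even, i.e. a(-θ) = a(θ) for all θ. Let a_n = (1/2π)∫_{-π}^{π} a(θ)e^{-inθ}dθ (n ∈ ℤ) be its Fourier coefficients, and for n ≥ 1 define b_n = (1/π)∫_{0}^{π} a(θ)(1+cos θ)(2cos θ)^{n-1} dθ (these are the moments (1/π)∫_{-1}^{1} b(x)(2x)^{n-1}dx of the function b on [-1,1] determined by b(cos θ) = a(θ)·√((1+cos θ)/(1-cos θ))). Then for every N ≥ 1, det(T_N(a) + H_N(a)) = det(b_{1+j+k})_{j,k=0}^{N-1}. -/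
open Real intervalIntegral

open Polynomial in
/-- If `p j` is monic of degree `j`, then the Gram determinant of a linear functional on `R[X]`
with respect to the `p j` equals its Hankel determinant of moments. -/
lemma det_gram_monic_eq_det_moments {R : Type*} [CommRing R] (Λ : R[X] →ₗ[R] R) (p : ℕ → R[X])
    (hdeg : ∀ n, (p n).natDegree = n) (hmonic : ∀ n, (p n).Monic) (N : ℕ) :
    (Matrix.of fun j k : Fin N => Λ (p j * p k)).det =
      (Matrix.of fun j k : Fin N => Λ (X ^ ((j : ℕ) + (k : ℕ)))).det := by
  set C : Matrix (Fin N) (Fin N) R := Matrix.of fun i j : Fin N => (p j).coeff i with hC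
  have hdet : C.det = 1 := Matrix.det_matrixOfPolynomials (fun i : Fin N => p i)
    (fun i => hdeg i) (fun i => hmonic i)
  have hsum (j : Fin N) : p j = ∑ l : Fin N, (p j).coeff l • X ^ (l : ℕ) := by
    conv_lhs => rw [(p j).as_sum_range' N ((hdeg j).trans_lt j.isLt)]
    rw [Finset.sum_range fun l => monomial l ((p j).coeff l)]
    simp only [smul_X_eq_monomial]
  have hmul : (Matrix.of fun j k : Fin N => Λ (p j * p k)) =
      C.transpose * (Matrix.of fun j k : Fin N => Λ (X ^ ((j : ℕ) + (k : ℕ)))) * C := by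
    ext j k
    rw [Matrix.of_apply, hsum j, hsum k, Finset.sum_mul_sum]
    simp only [Matrix.mul_apply, Matrix.transpose_apply, hC, Matrix.of_apply, map_sum,
      Finset.sum_mul]
    rw [Finset.sum_comm]
    refine Finset.sum_congr rfl fun m _ => Finset.sum_congr rfl fun l _ => ?_
    rw [smul_mul_smul_comm, ← pow_add, map_smul, smul_eq_mul]
    ring
  rw [hmul, Matrix.det_mul, Matrix.det_mul, Matrix.det_transpose, hdet, one_mul, mul_one]

open Polynomial in
/-- The rescaled Chebyshev polynomials of the third kind, determined by
`cos (θ / 2) * p n (2 * cos θ) = cos ((n + 1 / 2) * θ)`. -/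
noncomputable def chebyshevThird : ℕ → ℂ[X]
  | 0 => 1
  | 1 => X - C 1
  | n + 2 => X * chebyshevThird (n + 1) - chebyshevThird n

lemma chebyshevThird_natDegree_monic (n : ℕ) :
    (chebyshevThird n).natDegree = n ∧ (chebyshevThird n).Monic := by
  induction n using Nat.twoStepInduction with
  | zero => simp [chebyshevThird]
  | one => exact ⟨Polynomial.natDegree_X_sub_C 1, Polynomial.monic_X_sub_C 1⟩
  | more n h0 h1 =>
    have hX : (Polynomial.X * chebyshevThird (n + 1)).Monic := Polynomial.monic_X.mul h1.2
    have hXdeg : (Polynomial.X * chebyshevThird (n + 1)).natDegree = n + 2 := by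
      rw [Polynomial.natDegree_X_mul h1.2.ne_zero, h1.1]
    have hlt : (chebyshevThird n).natDegree <
        (Polynomial.X * chebyshevThird (n + 1)).natDegree := by
      rw [hXdeg, h0.1]; omega
    rw [chebyshevThird]
    exact ⟨by rw [Polynomial.natDegree_sub_eq_left_of_natDegree_lt hlt, hXdeg],
      hX.sub_of_left (Polynomial.degree_lt_degree hlt)⟩

lemma cos_half_mul_eval_chebyshevThird (z : ℂ) (n : ℕ) :
    Complex.cos (z / 2) * (chebyshevThird n).eval (2 * Complex.cos z) =
      Complex.cos ((n + 1 / 2) * z) := by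
  induction n using Nat.twoStepInduction with
  | zero =>
    simp only [chebyshevThird, Polynomial.eval_one, Nat.cast_zero]
    ring_nf
  | one =>
    have h1 : ((1 : ℕ) + 1 / 2 : ℂ) * z = z + z / 2 := by push_cast; ring
    have h2 : z / 2 = z - z / 2 := by ring
    have h3 := congrArg Complex.cos h2
    rw [Complex.cos_sub] at h3
    rw [h1, Complex.cos_add]
    simp only [chebyshevThird, Polynomial.eval_sub, Polynomial.eval_X, Polynomial.eval_C]
    linear_combination -h3
  | more n h0 h1 =>
    have h2 : ((n + 2 : ℕ) + 1 / 2 : ℂ) * z = ((n + 1 : ℕ) + 1 / 2) * z + z := by push_cast; ring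
    have h3 : (n + 1 / 2 : ℂ) * z = ((n + 1 : ℕ) + 1 / 2) * z - z := by push_cast; ring
    rw [h3, Complex.cos_sub] at h0
    rw [h2, Complex.cos_add]
    simp only [chebyshevThird, Polynomial.eval_sub, Polynomial.eval_mul, Polynomial.eval_X]
    linear_combination 2 * Complex.cos z * h1 - h0

lemma one_add_cos_mul_eval_chebyshevThird_mul (z : ℂ) (j k : ℕ) :
    (1 + Complex.cos z) * (chebyshevThird j * chebyshevThird k).eval (2 * Complex.cos z) =
      Complex.cos (((j : ℤ) - (k : ℤ) : ℤ) * z) +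
        Complex.cos (((j : ℤ) + (k : ℤ) + 1 : ℤ) * z) := by
  have hz : Complex.cos z = 2 * Complex.cos (z / 2) ^ 2 - 1 := by
    rw [← Complex.cos_two_mul]; ring_nf
  have hsub : (((j : ℤ) - (k : ℤ) : ℤ) : ℂ) * z = (j + 1 / 2) * z - (k + 1 / 2) * z := by
    push_cast; ring
  have hadd : (((j : ℤ) + (k : ℤ) + 1 : ℤ) : ℂ) * z = (j + 1 / 2) * z + (k + 1 / 2) * z := by
    push_cast; ring
  rw [hsub, hadd, Complex.cos_sub, Complex.cos_add, Polynomial.eval_mul]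
  linear_combination
    2 * Complex.cos (z / 2) * (chebyshevThird k).eval (2 * Complex.cos z) *
        cos_half_mul_eval_chebyshevThird z j +
      2 * Complex.cos ((j + 1 / 2) * z) * cos_half_mul_eval_chebyshevThird z k +
      (chebyshevThird j).eval (2 * Complex.cos z) * (chebyshevThird k).eval (2 * Complex.cos z) * hz

lemma integral_mul_exp_eq_two_mul_integral_mul_cos {a : ℝ → ℂ}
    (hint : IntervalIntegrable a MeasureTheory.volume (-π) π)
    (heven : ∀ θ : ℝ, a (-θ) = a θ) (n : ℤ) :
    ∫ θ in (-π)..π, a θ * Complex.exp (-Complex.I * n * θ) =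
      2 * ∫ θ in (0 : ℝ)..π, a θ * Complex.cos (n * θ) := by
  have hI : IntervalIntegrable (fun θ : ℝ => a θ * Complex.exp (-Complex.I * n * θ))
      MeasureTheory.volume (-π) π := hint.mul_continuousOn (by fun_prop)
  have hJ : IntervalIntegrable (fun θ : ℝ => a θ * Complex.exp (Complex.I * n * θ))
      MeasureTheory.volume (-π) π := hint.mul_continuousOn (by fun_prop)
  have hpi := pi_pos.le
  have hl : Set.uIcc (-π) 0 ⊆ Set.uIcc (-π) π := by
    rw [Set.uIcc_of_le (by linarith), Set.uIcc_of_le (by linarith)]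
    exact Set.Icc_subset_Icc_right hpi
  have hr : Set.uIcc 0 π ⊆ Set.uIcc (-π) π := by
    rw [Set.uIcc_of_le (by linarith), Set.uIcc_of_le (by linarith)]
    exact Set.Icc_subset_Icc_left (by linarith)
  have hneg : ∫ θ in (-π)..0, a θ * Complex.exp (-Complex.I * n * θ) =
      ∫ θ in (0 : ℝ)..π, a θ * Complex.exp (Complex.I * n * θ) := by
    have h := integral_comp_neg (a := 0) (b := π)
      (fun θ : ℝ => a θ * Complex.exp (-Complex.I * n * θ))
    rw [neg_zero] at h
    rw [← h]
    refine integral_congr fun θ _ => ?_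
    simp [heven]
  rw [← integral_add_adjacent_intervals (hI.mono_set hl) (hI.mono_set hr), hneg,
    ← integral_add (hJ.mono_set hr) (hI.mono_set hr), ← integral_const_mul]
  refine integral_congr fun θ _ => ?_
  have h := Complex.two_cos (n * θ : ℂ)
  have h1 : (n * θ : ℂ) * Complex.I = Complex.I * n * θ := by ring
  have h2 : -(n * θ : ℂ) * Complex.I = -Complex.I * n * θ := by ring
  rw [h1, h2] at h
  linear_combination -a θ * h

/-- Let `a : ℝ → ℂ` be `2π`-periodic, integrable on `[-π, π]` and even,
with Fourier coefficients `aF n = (1/(2π)) ∫_{-π}^{π} a θ e^{-inθ} dθ`, and for `n ≥ 1` let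
`b n = (1/π) ∫_0^π a θ (1 + cos θ) (2 cos θ)^{n-1} dθ`.  Then for every `N ≥ 1`,
`det (T_N(a) + H_N(a)) = det (b (1+j+k))_{j,k}`. -/
theorem statement3 (a : ℝ → ℂ)
    (hper : ∀ θ : ℝ, a (θ + 2 * π) = a θ)
    (hint : IntervalIntegrable a MeasureTheory.volume (-π) π)
    (heven : ∀ θ : ℝ, a (-θ) = a θ)
    (aF : ℤ → ℂ)
    (haF : ∀ n : ℤ,
      aF n = (1 / (2 * (π : ℂ))) * ∫ θ in (-π)..π, a θ * Complex.exp (-Complex.I * n * θ))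
    (b : ℕ → ℂ)
    (hb : ∀ n : ℕ, 1 ≤ n →
      b n = (1 / (π : ℂ)) * ∫ θ in (0:ℝ)..π,
        a θ * (1 + (Real.cos θ : ℂ)) * (2 * (Real.cos θ : ℂ)) ^ (n - 1))
    (N : ℕ) (hN : 1 ≤ N) :
    Matrix.det
        ((Matrix.of fun j k : Fin N => aF ((j : ℤ) - (k : ℤ))) +
          (Matrix.of fun j k : Fin N => aF ((j : ℤ) + (k : ℤ) + 1)))
      = Matrix.det (Matrix.of fun j k : Fin N => b (1 + (j : ℕ) + (k : ℕ))) := by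
  have hpi := pi_pos.le
  have hint' : IntervalIntegrable a MeasureTheory.volume 0 π := hint.mono_set <| by
    rw [Set.uIcc_of_le (by linarith), Set.uIcc_of_le (by linarith)]
    exact Set.Icc_subset_Icc_left (by linarith)
  have hmoment (q : Polynomial ℂ) : IntervalIntegrable
      (fun θ : ℝ => a θ * ((1 + Complex.cos θ) * q.eval (2 * Complex.cos θ)))
      MeasureTheory.volume 0 π := hint'.mul_continuousOn (by fun_prop)
  have hcos (n : ℤ) : IntervalIntegrable (fun θ : ℝ => a θ * Complex.cos (n * θ))
      MeasureTheory.volume 0 π := hint'.mul_continuousOn (by fun_prop)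
  let Λ : Polynomial ℂ →ₗ[ℂ] ℂ :=
    { toFun := fun q => (1 / (π : ℂ)) *
        ∫ θ in (0 : ℝ)..π, a θ * ((1 + Complex.cos θ) * q.eval (2 * Complex.cos θ))
      map_add' := fun q r => by
        rw [← mul_add, ← integral_add (hmoment q) (hmoment r)]
        simp only [Polynomial.eval_add, mul_add]
      map_smul' := fun c q => by
        rw [RingHom.id_apply, smul_eq_mul, mul_left_comm, ← integral_const_mul c]
        congr 1
        refine integral_congr fun θ _ => ?_
        simp only [Polynomial.eval_smul, smul_eq_mul]
        ring }
  have hF (n : ℤ) : aF n = (1 / (π : ℂ)) * ∫ θ in (0 : ℝ)..π, a θ * Complex.cos (n * θ) := by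
    rw [haF, integral_mul_exp_eq_two_mul_integral_mul_cos hint heven]
    have : (π : ℂ) ≠ 0 := by exact_mod_cast pi_ne_zero
    field_simp
  have hgram := det_gram_monic_eq_det_moments Λ chebyshevThird
    (fun n => (chebyshevThird_natDegree_monic n).1)
    (fun n => (chebyshevThird_natDegree_monic n).2) N
  convert hgram using 2
  · ext j k
    change aF _ + aF _ = (1 / (π : ℂ)) * ∫ θ in (0 : ℝ)..π, a θ *
      ((1 + Complex.cos θ) * Polynomial.eval (2 * Complex.cos θ) (chebyshevThird j * chebyshevThird k))
    rw [hF, hF, ← mul_add, ← integral_add (hcos _) (hcos _)]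
    simp only [one_add_cos_mul_eval_chebyshevThird_mul, mul_add]
  · ext j k
    change b _ = (1 / (π : ℂ)) * ∫ θ in (0 : ℝ)..π, a θ *
      ((1 + Complex.cos θ) * Polynomial.eval (2 * Complex.cos θ) (Polynomial.X ^ ((j : ℕ) + (k : ℕ))))
    rw [hb _ (by omega), show 1 + (j : ℕ) + (k : ℕ) - 1 = j + k by omega]
    simp only [Polynomial.eval_pow, Polynomial.eval_X, Complex.ofReal_cos, mul_assoc]
end

section
/- Let a : ℝ → ℂ be 2π-periodic, integrable on [-π,π], and even, i.e. a(-θ) = a(θ) for all θ, with Fourier coefficients a_m = (1/2π)∫_{-π}^{π} a(θ)e^{-imθ}dθ (m ∈ ℤ). Then for every n ≥ 1: (1/π)∫_{0}^{π} a(θ)(1+cos θ)(2cos θ)^{n-1} dθ = Σ_{k=0}^{n-1} C(n-1,k)·(a_{-n+1+2k} + a_{-n+2+2k}). -/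
open Real Finset intervalIntegral

/-- The integral over a symmetric interval folds onto its nonnegative half. -/
theorem integral_neg_self_eq_integral_add_comp_neg {f : ℝ → ℂ} {b : ℝ} (hb : 0 ≤ b)
    (hf : IntervalIntegrable f MeasureTheory.volume (-b) b) :
    ∫ x in (-b)..b, f x = ∫ x in (0 : ℝ)..b, (f x + f (-x)) := by
  have hleft : IntervalIntegrable f MeasureTheory.volume (-b) 0 :=
    hf.mono_set (by
      rw [Set.uIcc_of_le (by linarith), Set.uIcc_of_le (by linarith)]
      exact Set.Icc_subset_Icc_right hb)
  have hright : IntervalIntegrable f MeasureTheory.volume 0 b :=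
    hf.mono_set (by
      rw [Set.uIcc_of_le hb, Set.uIcc_of_le (by linarith)]
      exact Set.Icc_subset_Icc_left (by linarith))
  have hneg : IntervalIntegrable (fun x => f (-x)) MeasureTheory.volume 0 b := by
    simpa using ((IntervalIntegrable.iff_comp_neg).1 hleft).symm
  rw [integral_add hright hneg, integral_comp_neg, neg_zero, add_comm,
    integral_add_adjacent_intervals hleft hright]

/-- Binomial expansion of `(2 cos θ) ^ N * (1 + e^{-iθ})` into complex exponentials. -/
theorem sum_choose_mul_exp_add_exp (N : ℕ) (θ : ℝ) :
    ∑ k ∈ Finset.range (N + 1), (N.choose k : ℂ) *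
        (Complex.exp (-Complex.I * ((-((N + 1 : ℕ) : ℤ) + 1 + 2 * k : ℤ) : ℂ) * θ) +
          Complex.exp (-Complex.I * ((-((N + 1 : ℕ) : ℤ) + 2 + 2 * k : ℤ) : ℂ) * θ)) =
      (2 * (Real.cos θ : ℂ)) ^ N * (1 + Complex.exp (-Complex.I * θ)) := by
  rw [Complex.ofReal_cos, Complex.two_cos, add_comm (Complex.exp _), add_pow, Finset.sum_mul]
  refine Finset.sum_congr rfl fun k hk => ?_
  have hkN : k ≤ N := Nat.lt_succ_iff.mp (Finset.mem_range.mp hk)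
  rw [← Complex.exp_nat_mul, ← Complex.exp_nat_mul, ← Complex.exp_add, mul_comm (Complex.exp _) (N.choose k : ℂ),
    mul_assoc (N.choose k : ℂ), mul_one_add, ← Complex.exp_add]
  push_cast [Nat.cast_sub hkN]
  congr 3 <;> ring

/-- Let `a : ℝ → ℂ` be `2π`-periodic, integrable on `[-π, π]` and even,
with Fourier coefficients `aF m = (1/(2π)) ∫_{-π}^{π} a θ e^{-imθ} dθ`.  Then for every `n ≥ 1`:
`(1/π) ∫_0^π a θ (1+cos θ)(2 cos θ)^{n-1} dθ
   = ∑_{k=0}^{n-1} C(n-1,k) (aF (-n+1+2k) + aF (-n+2+2k))`. -/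
theorem statement4 (a : ℝ → ℂ)
    (hper : ∀ θ : ℝ, a (θ + 2 * π) = a θ)
    (hint : IntervalIntegrable a MeasureTheory.volume (-π) π)
    (heven : ∀ θ : ℝ, a (-θ) = a θ)
    (aF : ℤ → ℂ)
    (haF : ∀ m : ℤ,
      aF m = (1 / (2 * (π : ℂ))) * ∫ θ in (-π)..π, a θ * Complex.exp (-Complex.I * m * θ))
    (n : ℕ) (hn : 1 ≤ n) :
    (1 / (π : ℂ)) * (∫ θ in (0:ℝ)..π,
        a θ * (1 + (Real.cos θ : ℂ)) * (2 * (Real.cos θ : ℂ)) ^ (n - 1))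
      = ∑ k ∈ Finset.range n,
          ((n - 1).choose k : ℂ) * (aF (-(n : ℤ) + 1 + 2 * k) + aF (-(n : ℤ) + 2 + 2 * k)) := by
  obtain ⟨N, rfl⟩ : ∃ N, n = N + 1 := ⟨n - 1, by omega⟩
  simp only [Nat.add_sub_cancel]
  have hexp (m : ℤ) : IntervalIntegrable (fun θ : ℝ => a θ * Complex.exp (-Complex.I * m * θ))
      MeasureTheory.volume (-π) π :=
    hint.mul_continuousOn (by fun_prop)
  have hF : IntervalIntegrable
      (fun θ : ℝ => a θ * ((2 * (Real.cos θ : ℂ)) ^ N * (1 + Complex.exp (-Complex.I * θ))))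
      MeasureTheory.volume (-π) π :=
    hint.mul_continuousOn (by fun_prop)
  have hsum : ∑ k ∈ Finset.range (N + 1), (N.choose k : ℂ) *
      (aF (-((N + 1 : ℕ) : ℤ) + 1 + 2 * k) + aF (-((N + 1 : ℕ) : ℤ) + 2 + 2 * k)) =
      (1 / (2 * (π : ℂ))) * ∫ θ in (-π)..π,
        a θ * ((2 * (Real.cos θ : ℂ)) ^ N * (1 + Complex.exp (-Complex.I * θ))) := by
    simp_rw [← sum_choose_mul_exp_add_exp, Finset.mul_sum]
    rw [integral_finsetSum fun k _ => ?_, Finset.mul_sum]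
    · refine Finset.sum_congr rfl fun k _ => ?_
      rw [haF, haF, ← mul_add, ← integral_add (hexp _) (hexp _), mul_left_comm,
        ← integral_const_mul]
      congr 2
      ext θ
      ring
    · exact hint.mul_continuousOn (by fun_prop)
  rw [hsum, integral_neg_self_eq_integral_add_comp_neg Real.pi_pos.le hF]
  have hfold (θ : ℝ) :
      a θ * ((2 * (Real.cos θ : ℂ)) ^ N * (1 + Complex.exp (-Complex.I * θ))) +
        a (-θ) * ((2 * (Real.cos (-θ) : ℂ)) ^ N *
          (1 + Complex.exp (-Complex.I * (-θ : ℝ)))) =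
      2 * (a θ * (1 + (Real.cos θ : ℂ)) * (2 * (Real.cos θ : ℂ)) ^ N) := by
    have hcos : 2 * (Real.cos θ : ℂ) =
        Complex.exp (-Complex.I * (-θ : ℝ)) + Complex.exp (-Complex.I * θ) := by
      rw [Complex.ofReal_cos, Complex.two_cos]
      push_cast
      congr 2 <;> ring
    rw [heven, Real.cos_neg]
    linear_combination (-(a θ * (2 * (Real.cos θ : ℂ)) ^ N)) * hcos
  simp_rw [hfold]
  rw [integral_const_mul]
  have hpi : (π : ℂ) ≠ 0 := Complex.ofReal_ne_zero.mpr Real.pi_ne_zero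
  rw [← mul_assoc]
  congr 1
  field_simp
end

section
/- Let a : ℤ → ℂ be a sequence with a_{-n} = a_n for all n ∈ ℤ and a_{2n+1} = 0 for all n ∈ ℤ (these conditions correspond to a symbol satisfying a(-t) = a(t^{-1}) = a(t)). Define d : ℤ → ℂ by d_n = a_{2n} (corresponding to d(e^{iθ}) = a(e^{iθ/2})). Then for every N ≥ 1, det(T_N(a) + H_N(a)) = det T_N(d). -/
/-- The map sending the even indices increasingly and the odd indices decreasingly away from the
centre `N / 2`, so that `0, 1, 2, 3, …` becomes `0, -1, 1, -2, …` relative to the centre. -/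
def zigzagIndex (N : ℕ) (j : Fin N) : Fin N :=
  ⟨if (j : ℕ) % 2 = 0 then N / 2 + j / 2 else N / 2 - (j + 1) / 2, by
    have := j.isLt
    split_ifs <;> omega⟩

theorem zigzagIndex_injective (N : ℕ) : Function.Injective (zigzagIndex N) := by
  intro j k h
  have hj := j.isLt
  have hk := k.isLt
  simp only [zigzagIndex, Fin.mk.injEq] at h
  ext
  split_ifs at h <;> omega

/-- The zigzag reordering as a permutation of `Fin N`. -/
noncomputable def zigzagPerm (N : ℕ) : Equiv.Perm (Fin N) :=
  Equiv.ofBijective (zigzagIndex N) (Finite.injective_iff_bijective.mp (zigzagIndex_injective N))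

theorem coe_zigzagPerm {N : ℕ} (j : Fin N) :
    ((zigzagPerm N j : ℕ) : ℤ) =
      if (j : ℕ) % 2 = 0 then (N / 2 : ℤ) + j / 2 else (N / 2 : ℤ) - (j + 1) / 2 := by
  have := j.isLt
  simp only [zigzagPerm, Equiv.ofBijective_apply, zigzagIndex]
  split_ifs <;> omega

/-- Let `a : ℤ → ℂ` satisfy `a (-n) = a n` and `a (2n+1) = 0` for all `n`
(quarter wave symmetry `a(-t) = a(t⁻¹) = a(t)`), and set `d n = a (2n)`.
Then for every `N ≥ 1`, `det (T_N(a) + H_N(a)) = det T_N(d)`. -/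
theorem statement5 (a : ℤ → ℂ) (ha : ∀ n : ℤ, a (-n) = a n)
    (hodd : ∀ n : ℤ, a (2 * n + 1) = 0)
    (d : ℤ → ℂ) (hd : ∀ n : ℤ, d n = a (2 * n))
    (N : ℕ) (hN : 1 ≤ N) :
    Matrix.det
        ((Matrix.of fun j k : Fin N => a ((j : ℤ) - (k : ℤ))) +
          (Matrix.of fun j k : Fin N => a ((j : ℤ) + (k : ℤ) + 1)))
      = Matrix.det (Matrix.of fun j k : Fin N => d ((j : ℤ) - (k : ℤ))) := by
  rw [← Matrix.det_submatrix_equiv_self (zigzagPerm N)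
    (Matrix.of fun j k : Fin N => d ((j : ℤ) - (k : ℤ)))]
  congr 1
  ext j k
  simp only [Matrix.add_apply, Matrix.of_apply, Matrix.submatrix_apply, hd, coe_zigzagPerm]
  have zero_of_odd : ∀ m : ℤ, m % 2 = 1 → a m = 0 := fun m hm => by
    rw [show m = 2 * (m / 2) + 1 by omega, hodd]
  split_ifs with hj hk hk
  · rw [zero_of_odd (j + k + 1) (by omega), add_zero]
    congr 1
    omega
  · rw [zero_of_odd (j - k) (by omega), zero_add]
    congr 1
    omega
  · rw [zero_of_odd (j - k) (by omega), zero_add, ← ha]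
    congr 1
    omega
  · rw [zero_of_odd (j + k + 1) (by omega), add_zero, ← ha]
    congr 1
    omega
end

section
/- Let b_0 : [-1,1] → ℂ be a function with b_0(-x) = b_0(x) for all x ∈ [-1,1], such that x ↦ b_0(x)·√((1+x)/(1-x)) is integrable on [-1,1]. For n ≥ 1 define the moments b_n = (1/π)∫_{-1}^{1} b_0(x)·√((1+x)/(1-x))·(2x)^{n-1} dx, and for n ∈ ℤ define d_n = (1/2π)∫_{-π}^{π} b_0(cos(θ/2))e^{-inθ}dθ (the Fourier coefficients of d(e^{iθ}) = b_0(cos(θ/2))). Then for every N ≥ 1, det(b_{1+j+k})_{j,k=0}^{N-1} = det(d_{j-k})_{j,k=0}^{N-1}. -/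
open Real intervalIntegral

open MeasureTheory in
theorem intervalIntegrable_iff_sin_mul_comp_cos (f : ℝ → ℂ) :
    IntervalIntegrable f volume (-1) 1 ↔
      IntervalIntegrable (fun φ => (Real.sin φ : ℂ) * f (Real.cos φ)) volume 0 π := by
  have himg : Real.cos '' Set.Ioo 0 π = Set.Ioo (-1) 1 :=
    Real.cosPartialHomeomorph.image_source_eq_target
  rw [intervalIntegrable_iff_integrableOn_Ioo_of_le (by norm_num),
    intervalIntegrable_iff_integrableOn_Ioo_of_le Real.pi_pos.le, ← himg,
    integrableOn_image_iff_integrableOn_abs_deriv_smul measurableSet_Ioo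
      (fun x _ => (Real.hasDerivAt_cos x).hasDerivWithinAt)
      (Real.injOn_cos.mono Set.Ioo_subset_Icc_self)]
  refine integrableOn_congr_fun (fun x hx => ?_) measurableSet_Ioo
  simp [abs_of_pos (Real.sin_pos_of_mem_Ioo hx)]

open MeasureTheory in
theorem integral_eq_integral_sin_mul_cos (f : ℝ → ℂ) :
    ∫ x in (-1:ℝ)..1, f x = ∫ φ in (0:ℝ)..π, (Real.sin φ : ℂ) * f (Real.cos φ) := by
  have himg : Real.cos '' Set.Ioo 0 π = Set.Ioo (-1) 1 :=
    Real.cosPartialHomeomorph.image_source_eq_target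
  rw [integral_of_le (by norm_num), integral_of_le Real.pi_pos.le, integral_Ioc_eq_integral_Ioo,
    integral_Ioc_eq_integral_Ioo, ← himg,
    integral_image_eq_integral_abs_deriv_smul measurableSet_Ioo
      (fun x _ => (Real.hasDerivAt_cos x).hasDerivWithinAt)
      (Real.injOn_cos.mono Set.Ioo_subset_Icc_self)]
  refine setIntegral_congr_fun measurableSet_Ioo (fun x hx => ?_)
  simp [abs_of_pos (Real.sin_pos_of_mem_Ioo hx)]

theorem sin_mul_sqrt_one_add_cos_div {φ : ℝ} (hφ : φ ∈ Set.Ioo 0 π) :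
    Real.sin φ * √((1 + Real.cos φ) / (1 - Real.cos φ)) = 1 + Real.cos φ := by
  have hs := Real.sin_pos_of_mem_Ioo hφ
  have hsq := Real.sin_sq_add_cos_sq φ
  have h1 : 0 < 1 - Real.cos φ := by nlinarith [Real.neg_one_le_cos φ, Real.cos_le_one φ]
  have h2 : 0 < 1 + Real.cos φ := by nlinarith [Real.neg_one_le_cos φ, Real.cos_le_one φ]
  have : (1 + Real.cos φ) / (1 - Real.cos φ) = ((1 + Real.cos φ) / Real.sin φ) ^ 2 := by
    field_simp
    linear_combination hsq
  rw [this, Real.sqrt_sq (by positivity)]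
  field_simp

theorem integral_mul_sqrt_weight (f : ℝ → ℂ) :
    ∫ x in (-1:ℝ)..1, f x * (√((1 + x) / (1 - x)) : ℂ) =
      ∫ φ in (0:ℝ)..π, f (Real.cos φ) * (1 + Real.cos φ) := by
  rw [integral_eq_integral_sin_mul_cos, integral_of_le Real.pi_pos.le,
    integral_of_le Real.pi_pos.le, MeasureTheory.integral_Ioc_eq_integral_Ioo,
    MeasureTheory.integral_Ioc_eq_integral_Ioo]
  refine MeasureTheory.setIntegral_congr_fun measurableSet_Ioo (fun x hx => ?_)
  have := congrArg Complex.ofReal (sin_mul_sqrt_one_add_cos_div hx)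
  push_cast at this ⊢
  linear_combination f (Real.cos x) * this

open MeasureTheory in
theorem intervalIntegrable_comp_cos {f : ℝ → ℂ}
    (hsym : ∀ x ∈ Set.Icc (-1 : ℝ) 1, f (-x) = f x)
    (hint : IntervalIntegrable (fun x : ℝ => f x * (√((1 + x) / (1 - x)) : ℂ)) volume (-1) 1) :
    IntervalIntegrable (fun φ => f (Real.cos φ)) volume 0 π := by
  have h1 : IntervalIntegrable (fun φ => f (Real.cos φ) * (1 + Real.cos φ)) volume 0 π := by
    rw [intervalIntegrable_iff_sin_mul_comp_cos,
      intervalIntegrable_iff_integrableOn_Ioo_of_le Real.pi_pos.le] at hint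
    rw [intervalIntegrable_iff_integrableOn_Ioo_of_le Real.pi_pos.le]
    refine hint.congr_fun (fun x hx => ?_) measurableSet_Ioo
    have := congrArg Complex.ofReal (sin_mul_sqrt_one_add_cos_div hx)
    push_cast at this ⊢
    linear_combination f (Real.cos x) * this
  have h2 : IntervalIntegrable (fun φ => f (Real.cos φ) * (1 - Real.cos φ)) volume 0 π := by
    have := (h1.comp_sub_left π).symm
    simp only [sub_zero, sub_self, Real.cos_pi_sub, hsym _ (Real.cos_mem_Icc _)] at this
    simpa [sub_eq_add_neg] using this
  refine ((h1.add h2).const_mul (1 / 2)).congr (fun x _ => ?_)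
  ring

theorem exists_monic_half_angle_cos (n : ℕ) :
    ∃ p : Polynomial ℂ, p.Monic ∧ p.natDegree = n ∧ ∀ z : ℂ,
      Complex.cos z * p.eval (2 * Complex.cos (2 * z)) = Complex.cos ((2 * n + 1) * z) := by
  induction n using Nat.twoStepInduction with
  | zero => exact ⟨1, Polynomial.monic_one, by simp, by simp⟩
  | one =>
    refine ⟨Polynomial.X - Polynomial.C 1, Polynomial.monic_X_sub_C 1,
      Polynomial.natDegree_X_sub_C 1, fun z => ?_⟩
    have : (2 * ((1 : ℕ) : ℂ) + 1) * z = 3 * z := by push_cast; ring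
    rw [this, Complex.cos_three_mul, Complex.cos_two_mul]
    simp
    ring
  | more n ih₀ ih₁ =>
    obtain ⟨p, _, hp, hpz⟩ := ih₀
    obtain ⟨q, hqm, hq, hqz⟩ := ih₁
    have hm : (Polynomial.X * q).Monic := Polynomial.monic_X.mul hqm
    have hd : (Polynomial.X * q).natDegree = n + 2 := by
      rw [Polynomial.natDegree_X_mul hqm.ne_zero, hq]
    have hlt : p.natDegree < (Polynomial.X * q).natDegree := by omega
    refine ⟨Polynomial.X * q - p, hm.sub_of_left (Polynomial.degree_lt_degree hlt),
      by rw [Polynomial.natDegree_sub_eq_left_of_natDegree_lt hlt, hd], fun z => ?_⟩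
    have h1 : Complex.cos ((2 * n + 1) * z) =
        Complex.cos ((2 * (n + 1 : ℕ) + 1) * z - 2 * z) := by push_cast; ring_nf
    have h2 : Complex.cos ((2 * (n + 2 : ℕ) + 1) * z) =
        Complex.cos ((2 * (n + 1 : ℕ) + 1) * z + 2 * z) := by push_cast; ring_nf
    have h3 := hpz z
    have h4 := hqz z
    rw [h1, Complex.cos_sub] at h3
    rw [h2, Complex.cos_add]
    simp only [Polynomial.eval_sub, Polynomial.eval_mul, Polynomial.eval_X]
    linear_combination 2 * Complex.cos (2 * z) * h4 - h3

open MeasureTheory in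
/-- The Hankel determinant is unchanged when monomials are replaced by monic polynomials. -/
theorem det_hankel_eq_det_of_monic {w : ℝ → ℂ} {u : ℝ → ℂ} {a c : ℝ}
    (hw : IntervalIntegrable w volume a c) (hu : Continuous u) {N : ℕ}
    (p : ℕ → Polynomial ℂ) (hm : ∀ n, (p n).Monic) (hdeg : ∀ n, (p n).natDegree = n) :
    Matrix.det (Matrix.of fun j k : Fin N => ∫ φ in a..c, w φ * u φ ^ ((j : ℕ) + (k : ℕ))) =
      Matrix.det (Matrix.of fun j k : Fin N =>
        ∫ φ in a..c, w φ * ((p j).eval (u φ) * (p k).eval (u φ))) := by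
  set A : Matrix (Fin N) (Fin N) ℂ := Matrix.of fun i j => (p j).coeff i with hA
  set H : Matrix (Fin N) (Fin N) ℂ :=
    Matrix.of fun j k : Fin N => ∫ φ in a..c, w φ * u φ ^ ((j : ℕ) + (k : ℕ)) with hH
  have hdet : A.det = 1 :=
    Matrix.det_matrixOfPolynomials (fun i : Fin N => p i) (fun i => hdeg i) (fun i => hm i)
  have heval (j : Fin N) (x : ℂ) : (p j).eval x = ∑ i : Fin N, (p j).coeff i * x ^ (i : ℕ) := by
    rw [Polynomial.eval_eq_sum_range' (n := N) (by rw [hdeg]; exact j.2),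
      Fin.sum_univ_eq_sum_range (fun i => (p j).coeff i * x ^ i)]
  have hprod : A.transpose * H * A = Matrix.of fun j k : Fin N =>
      ∫ φ in a..c, w φ * ((p j).eval (u φ) * (p k).eval (u φ)) := by
    ext j k
    have hi (m l : Fin N) : IntervalIntegrable
        (fun φ => (p j).coeff m * (p k).coeff l * (w φ * u φ ^ ((m : ℕ) + (l : ℕ))))
        volume a c :=
      (hw.mul_continuousOn (by fun_prop)).const_mul _
    have hfun : (fun φ => w φ * ((p j).eval (u φ) * (p k).eval (u φ))) = fun φ =>
        ∑ l : Fin N, ∑ m : Fin N,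
          (p j).coeff m * (p k).coeff l * (w φ * u φ ^ ((m : ℕ) + (l : ℕ))) := by
      ext φ
      rw [heval, heval, Finset.sum_mul_sum, Finset.mul_sum]
      simp only [Finset.mul_sum]
      rw [Finset.sum_comm]
      refine Finset.sum_congr rfl fun l _ => Finset.sum_congr rfl fun m _ => ?_
      ring
    simp only [Matrix.of_apply]
    rw [hfun, intervalIntegral.integral_finsetSum
      (fun l _ => by simpa only [Finset.sum_fn] using
        IntervalIntegrable.sum Finset.univ (fun m _ => hi m l))]
    rw [Matrix.mul_apply]
    refine Finset.sum_congr rfl fun l _ => ?_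
    rw [intervalIntegral.integral_finsetSum (fun m _ => hi m l), Matrix.mul_apply, Finset.sum_mul]
    refine Finset.sum_congr rfl fun m _ => ?_
    rw [intervalIntegral.integral_const_mul]
    simp only [hA, hH, Matrix.transpose_apply, Matrix.of_apply]
    ring
  rw [← hprod, Matrix.det_mul, Matrix.det_mul, Matrix.det_transpose, hdet]
  ring

/-- The index of `Fin N` that enumerates `0, -1, 1, -2, 2, …`, shifted by `N / 2`. -/
def zigzag (N : ℕ) (j : Fin N) : Fin N :=
  ⟨if (j : ℕ) % 2 = 0 then N / 2 + j / 2 else N / 2 - (j / 2 + 1), by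
    have := j.2
    split_ifs <;> omega⟩

theorem zigzag_injective (N : ℕ) : Function.Injective (zigzag N) := by
  intro j k h
  have hj := j.2
  have hk := k.2
  have h' := congrArg Fin.val h
  simp only [zigzag] at h'
  apply Fin.ext
  split_ifs at h' <;> omega

theorem det_toeplitz_add_hankel (N : ℕ) (e d : ℤ → ℂ) (hneg : ∀ n, d (-n) = d n)
    (heven : ∀ n, e (2 * n) = d n) (hodd : ∀ n, e (2 * n + 1) = 0) :
    Matrix.det (Matrix.of fun j k : Fin N => e ((j : ℤ) - k) + e ((j : ℤ) + k + 1)) =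
      Matrix.det (Matrix.of fun j k : Fin N => d ((j : ℤ) - (k : ℤ))) := by
  let τ : Fin N ≃ Fin N :=
    Equiv.ofBijective (zigzag N) (Finite.injective_iff_bijective.mp (zigzag_injective N))
  rw [← Matrix.det_submatrix_equiv_self τ (Matrix.of fun j k : Fin N => d ((j : ℤ) - (k : ℤ)))]
  congr 1
  ext j k
  have hτ (i : Fin N) : ((τ i : ℕ) : ℤ) =
      if (i : ℕ) % 2 = 0 then (N : ℤ) / 2 + (i : ℤ) / 2 else (N : ℤ) / 2 - ((i : ℤ) / 2 + 1) := by
    have := i.2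
    change (((if (i : ℕ) % 2 = 0 then N / 2 + i / 2 else N / 2 - (i / 2 + 1) : ℕ)) : ℤ) = _
    split_ifs <;> omega
  simp only [Matrix.submatrix_apply, Matrix.of_apply, hτ]
  obtain ⟨j, hj⟩ := j
  obtain ⟨k, hk⟩ := k
  simp only
  rcases Nat.even_or_odd' j with ⟨x, rfl | rfl⟩ <;> rcases Nat.even_or_odd' k with ⟨y, rfl | rfl⟩
  · rw [if_pos (by omega), if_pos (by omega),
      show ((2 * x : ℕ) : ℤ) - (2 * y : ℕ) = 2 * ((x : ℤ) - y) by omega,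
      show ((2 * x : ℕ) : ℤ) + (2 * y : ℕ) + 1 = 2 * ((x : ℤ) + y) + 1 by omega,
      heven, hodd, add_zero]
    congr 1
    omega
  · rw [if_pos (by omega), if_neg (by omega),
      show ((2 * x : ℕ) : ℤ) - (2 * y + 1 : ℕ) = 2 * ((x : ℤ) - y - 1) + 1 by omega,
      show ((2 * x : ℕ) : ℤ) + (2 * y + 1 : ℕ) + 1 = 2 * ((x : ℤ) + y + 1) by omega,
      heven, hodd, zero_add]
    congr 1
    omega
  · rw [if_neg (by omega), if_pos (by omega),
      show ((2 * x + 1 : ℕ) : ℤ) - (2 * y : ℕ) = 2 * ((x : ℤ) - y) + 1 by omega,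
      show ((2 * x + 1 : ℕ) : ℤ) + (2 * y : ℕ) + 1 = 2 * ((x : ℤ) + y + 1) by omega,
      heven, hodd, zero_add, ← hneg]
    congr 1
    omega
  · rw [if_neg (by omega), if_neg (by omega),
      show ((2 * x + 1 : ℕ) : ℤ) - (2 * y + 1 : ℕ) = 2 * ((x : ℤ) - y) by omega,
      show ((2 * x + 1 : ℕ) : ℤ) + (2 * y + 1 : ℕ) + 1 = 2 * ((x : ℤ) + y + 1) + 1 by omega,
      heven, hodd, add_zero, ← hneg]
    congr 1
    omega

theorem integral_reflect_eq {g : ℝ → ℂ} (hg : ∀ φ, g (π - φ) = g φ) (h : ℝ → ℂ) :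
    ∫ φ in (0:ℝ)..π, g φ * h (π - φ) = ∫ φ in (0:ℝ)..π, g φ * h φ := by
  have := intervalIntegral.integral_comp_sub_left (a := 0) (b := π) (fun φ => g φ * h φ) π
  simpa [hg] using this

theorem integral_mul_cos_odd {g : ℝ → ℂ} (hg : ∀ φ, g (π - φ) = g φ) (n : ℤ) :
    ∫ φ in (0:ℝ)..π, g φ * Real.cos ((2 * n + 1 : ℤ) * φ) = 0 := by
  have h := integral_reflect_eq hg (fun φ => (Real.cos ((2 * n + 1 : ℤ) * φ) : ℂ))
  have hc (φ : ℝ) : Real.cos ((2 * n + 1 : ℤ) * (π - φ)) = -Real.cos ((2 * n + 1 : ℤ) * φ) := by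
    rw [show ((2 * n + 1 : ℤ) : ℝ) * (π - φ) =
      π - (2 * n + 1 : ℤ) * φ + (n : ℤ) * (2 * π) by push_cast; ring,
      Real.cos_add_int_mul_two_pi, Real.cos_pi_sub]
  simp only [hc, Complex.ofReal_neg, mul_neg, intervalIntegral.integral_neg] at h
  exact neg_eq_self.mp h

theorem integral_mul_exp_eq_integral_mul_cos {g : ℝ → ℂ}
    (hg : ∀ φ, g (π - φ) = g φ) (hper : Function.Periodic g π)
    (hint : IntervalIntegrable g MeasureTheory.volume 0 π) (n : ℤ) :
    ∫ θ in (-π)..π, g (θ / 2) * Complex.exp (-Complex.I * n * θ) =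
      2 * ∫ φ in (0:ℝ)..π, g φ * Real.cos ((2 * n : ℤ) * φ) := by
  set E : ℤ → ℝ → ℂ := fun n φ => Complex.exp (-Complex.I * n * (2 * φ)) with hE
  have hEneg (n : ℤ) (φ : ℝ) : E n (π - φ) = E (-n) φ := by
    simp only [hE]
    rw [show -Complex.I * n * (2 * ((π - φ : ℝ) : ℂ)) =
      -Complex.I * (-n : ℤ) * (2 * φ) + (-n : ℤ) * (2 * π * Complex.I) by push_cast; ring,
      Complex.exp_add, Complex.exp_int_mul_two_pi_mul_I, mul_one]
  have hEper : Function.Periodic (E n) π := fun φ => by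
    simp only [hE]
    rw [show -Complex.I * n * (2 * ((φ + π : ℝ) : ℂ)) =
      -Complex.I * n * (2 * φ) + (-n : ℤ) * (2 * π * Complex.I) by push_cast; ring,
      Complex.exp_add, Complex.exp_int_mul_two_pi_mul_I, mul_one]
  have hEint (m : ℤ) :
      IntervalIntegrable (fun φ => g φ * E m φ) MeasureTheory.volume 0 π :=
    hint.mul_continuousOn (by fun_prop)
  have h1 : ∫ θ in (-π)..π, g (θ / 2) * Complex.exp (-Complex.I * n * θ) =
      2 * ∫ φ in (0:ℝ)..π, g φ * E n φ := by
    have h := intervalIntegral.integral_comp_div (a := -π) (b := π)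
      (fun φ => g φ * E n φ) two_ne_zero
    have h' := (hper.mul hEper).intervalIntegral_add_eq (-π / 2) 0
    rw [show -π / 2 + π = π / 2 by ring, zero_add] at h'
    simp only [Pi.mul_apply] at h'
    rw [h'] at h
    rw [show ((2 : ℂ)) = ((2 : ℝ) : ℂ) by simp, ← Complex.real_smul, ← h]
    refine intervalIntegral.integral_congr fun θ _ => ?_
    simp only [hE]
    congr 3
    push_cast
    ring
  have h2 := integral_reflect_eq hg (E n)
  simp only [hEneg] at h2
  have h3 : ∫ φ in (0:ℝ)..π, g φ * Real.cos ((2 * n : ℤ) * φ) =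
      (1 / 2) * ∫ φ in (0:ℝ)..π, (g φ * E n φ + g φ * E (-n) φ) := by
    rw [← intervalIntegral.integral_const_mul]
    refine intervalIntegral.integral_congr fun φ _ => ?_
    simp only [hE, Complex.ofReal_cos, Complex.cos]
    push_cast
    ring_nf
  rw [h1, h3, intervalIntegral.integral_add (hEint n) (hEint (-n)), h2]
  ring

/-- Let `b₀ : [-1,1] → ℂ` be even with `x ↦ b₀ x √((1+x)/(1-x))`
integrable on `[-1,1]`.  With moments
`b n = (1/π) ∫_{-1}^1 b₀ x √((1+x)/(1-x)) (2x)^{n-1} dx` (`n ≥ 1`) and Fourier coefficients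
`d n = (1/(2π)) ∫_{-π}^{π} b₀ (cos (θ/2)) e^{-inθ} dθ`, for every `N ≥ 1` we have
`det H_N[b] = det T_N(d)`. -/
theorem statement6 (b₀ : ℝ → ℂ)
    (hsym : ∀ x : ℝ, x ∈ Set.Icc (-1 : ℝ) 1 → b₀ (-x) = b₀ x)
    (hint : IntervalIntegrable (fun x : ℝ => b₀ x * (Real.sqrt ((1 + x) / (1 - x)) : ℂ))
      MeasureTheory.volume (-1) 1)
    (b : ℕ → ℂ)
    (hb : ∀ n : ℕ, 1 ≤ n →
      b n = (1 / (π : ℂ)) * ∫ x in (-1:ℝ)..1,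
        b₀ x * (Real.sqrt ((1 + x) / (1 - x)) : ℂ) * (2 * (x : ℂ)) ^ (n - 1))
    (d : ℤ → ℂ)
    (hd : ∀ n : ℤ,
      d n = (1 / (2 * (π : ℂ))) *
        ∫ θ in (-π)..π, b₀ (Real.cos (θ / 2)) * Complex.exp (-Complex.I * n * θ))
    (N : ℕ) (hN : 1 ≤ N) :
    Matrix.det (Matrix.of fun j k : Fin N => b (1 + (j : ℕ) + (k : ℕ)))
      = Matrix.det (Matrix.of fun j k : Fin N => d ((j : ℤ) - (k : ℤ))) := by
  set g : ℝ → ℂ := fun φ => b₀ (Real.cos φ) with hgdef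
  have hg (φ : ℝ) : g (π - φ) = g φ := by
    simp only [hgdef, Real.cos_pi_sub, hsym _ (Real.cos_mem_Icc φ)]
  have hper : Function.Periodic g π := fun φ => by
    simp only [hgdef, Real.cos_add_pi, hsym _ (Real.cos_mem_Icc φ)]
  have hgint : IntervalIntegrable g MeasureTheory.volume 0 π :=
    intervalIntegrable_comp_cos hsym hint
  have hcosint (m : ℤ) : IntervalIntegrable (fun φ => g φ * Real.cos (m * φ))
      MeasureTheory.volume 0 π := hgint.mul_continuousOn (by fun_prop)
  set e : ℤ → ℂ := fun m => (1 / (π : ℂ)) * ∫ φ in (0:ℝ)..π, g φ * Real.cos (m * φ) with he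
  have heven (n : ℤ) : e (2 * n) = d n := by
    rw [hd, integral_mul_exp_eq_integral_mul_cos hg hper hgint n]
    simp only [he]
    ring
  have hodd (n : ℤ) : e (2 * n + 1) = 0 := by
    simp only [he]
    rw [integral_mul_cos_odd hg n, mul_zero]
  have hneg (n : ℤ) : d (-n) = d n := by
    rw [← heven, ← heven]
    simp [he]
  rw [← det_toeplitz_add_hankel N e d hneg heven hodd]
  choose p hm hdeg hp using exists_monic_half_angle_cos
  have hw : IntervalIntegrable (fun φ => (1 / (π : ℂ)) * (g φ * (1 + Real.cos φ)))
      MeasureTheory.volume 0 π := (hgint.mul_continuousOn (by fun_prop)).const_mul _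
  have key := det_hankel_eq_det_of_monic hw (u := fun φ : ℝ => 2 * (Real.cos φ : ℂ))
    (by fun_prop) (N := N) p hm hdeg
  have hH (j k : ℕ) : b (1 + j + k) = ∫ φ in (0:ℝ)..π,
      (1 / (π : ℂ)) * (g φ * (1 + Real.cos φ)) * (2 * (Real.cos φ : ℂ)) ^ (j + k) := by
    have h := integral_mul_sqrt_weight (fun x => b₀ x * (2 * (x : ℂ)) ^ (j + k))
    rw [hb _ (by omega), show 1 + j + k - 1 = j + k by omega]
    simp only [mul_assoc, intervalIntegral.integral_const_mul]
    congr 1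
    refine Eq.trans ?_ (h.trans ?_)
    · exact intervalIntegral.integral_congr fun x _ => by ring
    · exact intervalIntegral.integral_congr fun x _ => by simp only [hgdef]; push_cast; ring
  have hT (j k : ℕ) : e ((j : ℤ) - k) + e ((j : ℤ) + k + 1) = ∫ φ in (0:ℝ)..π,
      (1 / (π : ℂ)) * (g φ * (1 + Real.cos φ)) *
        ((p j).eval (2 * (Real.cos φ : ℂ)) * (p k).eval (2 * (Real.cos φ : ℂ))) := by
    simp only [he]
    rw [← mul_add, ← intervalIntegral.integral_add (hcosint _) (hcosint _),
      ← intervalIntegral.integral_const_mul]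
    refine intervalIntegral.integral_congr fun φ _ => ?_
    have hj := hp j (φ / 2)
    have hk := hp k (φ / 2)
    have hcos := Complex.cos_two_mul ((φ : ℂ) / 2)
    rw [mul_div_cancel₀ (φ : ℂ) two_ne_zero] at hj hk hcos
    have h1 : Complex.cos (((j : ℤ) - k : ℤ) * φ) =
        Complex.cos ((2 * j + 1) * (φ / 2) - (2 * k + 1) * (φ / 2)) := by push_cast; ring_nf
    have h2 : Complex.cos (((j : ℤ) + k + 1 : ℤ) * φ) =
        Complex.cos ((2 * j + 1) * (φ / 2) + (2 * k + 1) * (φ / 2)) := by push_cast; ring_nf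
    simp only [Complex.ofReal_cos, Complex.ofReal_mul, Complex.ofReal_intCast]
    rw [h1, h2, Complex.cos_sub, Complex.cos_add, ← hj, ← hk]
    generalize (p j).eval (2 * Complex.cos φ) = P
    generalize (p k).eval (2 * Complex.cos φ) = Q
    rw [hcos]
    ring
  simpa only [hH, hT] using key
end

section
/- Let a : ℤ → ℂ be a sequence with a_{-n} = a_n for all n ∈ ℤ. Define c : ℤ → ℂ by c_n = Σ_{k=-n+1}^{n} a_k for n > 0, c_0 = 0, and c_{-n} = -c_n for n > 0. Then for every N ≥ 1, det T_{2N}(c) = (det(T_N(a) + H_N(a)))². -/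
open Finset

/-- A block matrix anticommuting with the swap of its two blocks has determinant
`det (Q - P) * det (P + Q)`. -/
lemma Matrix.det_fromBlocks_neg_neg {n R : Type*} [Fintype n] [DecidableEq n] [CommRing R]
    (P Q : Matrix n n R) :
    (Matrix.fromBlocks (-P) (-Q) Q P).det = (Q - P).det * (P + Q).det := by
  have h : Matrix.fromBlocks 1 1 0 1 * Matrix.fromBlocks (-P) (-Q) Q P *
      Matrix.fromBlocks 1 1 0 1 = Matrix.fromBlocks (Q - P) 0 Q (P + Q) := by
    simp only [Matrix.fromBlocks_multiply, one_mul, mul_one, zero_mul, mul_zero, zero_add,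
      add_zero]
    congr 1 <;> abel
  have h' := congrArg Matrix.det h
  simpa [Matrix.det_mul, Matrix.det_fromBlocks_zero₂₁, Matrix.det_fromBlocks_zero₁₂] using h'

/-- If every row of `B` is the corresponding row of `A` plus a multiple of the sum of the
previous rows of `A`, then `A` and `B` have the same determinant. -/
lemma Matrix.det_of_add_smul_sum_range {R : Type*} [CommRing R] (N : ℕ) (r : R)
    (A B : ℕ → ℕ → R) (h : ∀ j k, B j k = A j k + r * ∑ i ∈ Finset.range j, A i k) :
    (Matrix.of fun j k : Fin N => B j k).det = (Matrix.of fun j k : Fin N => A j k).det := by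
  let L : Matrix (Fin N) (Fin N) R :=
    Matrix.of fun j i => (if i = j then 1 else 0) + (if i < j then r else 0)
  have hL : L.det = 1 := by
    rw [Matrix.det_of_isLowerTriangular]
    · simp [L]
    · intro i j hij
      have hij' : i < j := hij
      simp [L, hij'.ne', hij'.not_gt]
  have hmul : (Matrix.of fun j k : Fin N => B j k) =
      L * Matrix.of fun j k : Fin N => A j k := by
    ext j k
    have hsum : ∑ i : Fin N, (if i < j then r * A i k else 0) =
        r * ∑ i ∈ Finset.range j, A i k := by
      have h1 := Fin.sum_univ_eq_sum_range
        (fun i => if i < (j : ℕ) then r * A i k else 0) N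
      simp only [Fin.lt_def]
      rw [h1, ← Finset.sum_filter, Finset.mul_sum]
      congr 1
      ext i
      have := j.isLt
      simp only [Finset.mem_filter, Finset.mem_range]
      omega
    simp [Matrix.mul_apply, L, add_mul, Finset.sum_add_distrib, ite_mul, hsum, h]
  rw [hmul, Matrix.det_mul, hL, one_mul]

/-- The determinant of a Toeplitz matrix of even order with odd symbol is the square of the
determinant of a Toeplitz plus Hankel matrix of half the order. -/
lemma det_toeplitz_two_mul_of_odd {R : Type*} [CommRing R] (c : ℤ → R)
    (hc : ∀ n, c (-n) = -c n) (N : ℕ) :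
    (Matrix.of fun j k : Fin (2 * N) => c ((j : ℤ) - (k : ℤ))).det =
      (Matrix.of fun j k : Fin N => c ((j : ℤ) - (k : ℤ)) + c ((j : ℤ) + (k : ℤ) + 1)).det
        ^ 2 := by
  let P : Matrix (Fin N) (Fin N) R := Matrix.of fun j k => c ((j : ℤ) - (k : ℤ))
  let Q : Matrix (Fin N) (Fin N) R := Matrix.of fun j k => c ((j : ℤ) + (k : ℤ) + 1)
  let e : Fin N ⊕ Fin N ≃ Fin (2 * N) :=
    (Equiv.sumCongr Fin.revPerm (Equiv.refl _)).trans
      (finSumFinEquiv.trans (finCongr (two_mul N).symm))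
  have hl (j : Fin N) : ((e (Sum.inl j) : ℕ) : ℤ) = N - 1 - j := by
    have : (e (Sum.inl j) : ℕ) = N - (j + 1) := by simp [e]
    omega
  have hr (j : Fin N) : ((e (Sum.inr j) : ℕ) : ℤ) = N + j := by simp [e, add_comm]
  have hblocks : (Matrix.of fun j k : Fin (2 * N) => c ((j : ℤ) - (k : ℤ))).submatrix e e =
      Matrix.fromBlocks (-P) (-Q) Q P := by
    ext (j | j) (k | k) <;>
      simp only [Matrix.submatrix_apply, Matrix.of_apply, hl, hr, Matrix.fromBlocks_apply₁₁,
        Matrix.fromBlocks_apply₁₂, Matrix.fromBlocks_apply₂₁, Matrix.fromBlocks_apply₂₂,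
        Matrix.neg_apply, P, Q, ← hc] <;>
      congr 1 <;> ring
  have htranspose : Q - P = (P + Q).transpose := by
    ext j k
    simp only [Matrix.sub_apply, Matrix.transpose_apply, Matrix.add_apply, Matrix.of_apply, P, Q]
    rw [← neg_sub (j : ℤ) k, hc, add_comm (k : ℤ) j]
    ring
  rw [← Matrix.det_submatrix_equiv_self e, hblocks, Matrix.det_fromBlocks_neg_neg, htranspose,
    Matrix.det_transpose, ← sq]
  rfl

/-- Let `a : ℤ → ℂ` be even and let `c n = ∑_{k=-n+1}^{n} a k` for `n > 0`,
`c 0 = 0`, `c (-n) = -c n`.  Then for every `N ≥ 1`,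
`det T_{2N}(c) = (det (T_N(a) + H_N(a)))²`. -/
theorem statement7 (a : ℤ → ℂ) (ha : ∀ n : ℤ, a (-n) = a n)
    (c : ℤ → ℂ)
    (hc : ∀ n : ℤ, 0 < n → c n = ∑ k ∈ Finset.Icc (-n + 1) n, a k)
    (hc0 : c 0 = 0)
    (hcneg : ∀ n : ℤ, 0 < n → c (-n) = -c n)
    (N : ℕ) (hN : 1 ≤ N) :
    Matrix.det (Matrix.of fun j k : Fin (2 * N) => c ((j : ℤ) - (k : ℤ)))
      = (Matrix.det
          ((Matrix.of fun j k : Fin N => a ((j : ℤ) - (k : ℤ))) +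
            (Matrix.of fun j k : Fin N => a ((j : ℤ) + (k : ℤ) + 1)))) ^ 2 := by
  have hodd (n : ℤ) : c (-n) = -c n := by
    rcases lt_trichotomy n 0 with h | rfl | h
    · have := hcneg (-n) (by omega)
      rw [neg_neg] at this
      rw [this, neg_neg]
    · simp [hc0]
    · exact hcneg n h
  have hstep_nonneg (n : ℤ) (hn : 0 ≤ n) : c (n + 1) = c n + a n + a (n + 1) := by
    have hc' : c n = ∑ k ∈ Finset.Icc (-n + 1) n, a k := by
      rcases hn.eq_or_lt with rfl | h
      · simp [hc0]
      · exact hc n h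
    have hIcc : Finset.Icc (-(n + 1) + 1) (n + 1) =
        insert (-n) (insert (n + 1) (Finset.Icc (-n + 1) n)) := by
      ext k
      simp only [Finset.mem_Icc, Finset.mem_insert]
      omega
    rw [hc (n + 1) (by omega), hIcc, Finset.sum_insert, Finset.sum_insert, ha, hc']
    · ring
    · simp
    · simp only [Finset.mem_Icc, Finset.mem_insert]
      omega
  have hstep (n : ℤ) : c (n + 1) = c n + a n + a (n + 1) := by
    rcases le_or_gt 0 n with h | h
    · exact hstep_nonneg n h
    · have h1 := hstep_nonneg (-(n + 1)) (by omega)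
      rw [show -(n + 1) + 1 = -n by ring, hodd, hodd, ha, ha] at h1
      linear_combination h1
  rw [det_toeplitz_two_mul_of_odd c hodd]
  congr 1
  refine Matrix.det_of_add_smul_sum_range N 2
    (fun j k => a ((j : ℤ) - (k : ℤ)) + a ((j : ℤ) + (k : ℤ) + 1))
    (fun j k => c ((j : ℤ) - (k : ℤ)) + c ((j : ℤ) + (k : ℤ) + 1)) fun j k => ?_
  induction j with
  | zero =>
    simp only [Nat.cast_zero, zero_sub, zero_add, hodd, ha, hstep, Finset.range_zero,
      Finset.sum_empty]
    ring
  | succ j ih =>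
    have h1 := hstep ((j : ℤ) - k)
    have h2 := hstep ((j : ℤ) + k + 1)
    simp only [Nat.cast_succ, Finset.sum_range_succ] at ih ⊢
    rw [show (j : ℤ) + 1 - k = j - k + 1 by ring,
      show (j : ℤ) + 1 + k + 1 = j + k + 1 + 1 by ring]
    linear_combination ih + h1 + h2
end

section
/- Let a : ℤ → ℂ be a sequence with a_{-n} = a_n for all n ∈ ℤ, and define c : ℤ → ℂ by c_n = Σ_{k=-n+1}^{n} a_k for n > 0, c_0 = 0, c_{-n} = -c_n for n > 0. Let S be the N×N lower shift matrix, i.e. S_{j,k} = 1 if j = k+1 and S_{j,k} = 0 otherwise, and let I_N be the N×N identity matrix. Then (I_N - S)·(T_N(c) + H_N(c)) = (I_N + S)·(T_N(a) + H_N(a)). -/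
open Finset

/-- Multiplying by the lower shift matrix clears the first row. -/
theorem shift_mul_apply_zero {N : ℕ} {S : Matrix (Fin N) (Fin N) ℂ}
    (hS : ∀ j k : Fin N, S j k = if (j : ℕ) = (k : ℕ) + 1 then 1 else 0)
    (M : Matrix (Fin N) (Fin N) ℂ) {j : Fin N} (hj : (j : ℕ) = 0) (k : Fin N) :
    (S * M) j k = 0 := by
  simp [Matrix.mul_apply, hS, hj]

/-- Multiplying by the lower shift matrix moves every row down by one. -/
theorem shift_mul_apply_succ {N : ℕ} {S : Matrix (Fin N) (Fin N) ℂ}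
    (hS : ∀ j k : Fin N, S j k = if (j : ℕ) = (k : ℕ) + 1 then 1 else 0)
    (M : Matrix (Fin N) (Fin N) ℂ) {i j : Fin N} (hij : (j : ℕ) = (i : ℕ) + 1) (k : Fin N) :
    (S * M) j k = M i k := by
  rw [Matrix.mul_apply, Finset.sum_eq_single i]
  · simp [hS, hij]
  · intro l _ hl
    have : (j : ℕ) ≠ (l : ℕ) + 1 := fun h => hl (Fin.ext (by omega))
    simp [hS, this]
  · simp

/-- A symmetric interval sum grows by its two outermost terms. -/
theorem sum_Icc_neg_succ_sub (a : ℤ → ℂ) {n : ℤ} (hn : 0 ≤ n) :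
    ∑ k ∈ Finset.Icc (-(n + 1) + 1) (n + 1), a k =
      ∑ k ∈ Finset.Icc (-n + 1) n, a k + a (n + 1) + a (-n) := by
  have h : Finset.Icc (-(n + 1) + 1) (n + 1) =
      insert (-n) (insert (n + 1) (Finset.Icc (-n + 1) n)) := by
    ext x
    simp only [Finset.mem_insert, Finset.mem_Icc]
    omega
  rw [h, Finset.sum_insert, Finset.sum_insert]
  · ring
  · simp
  · simp only [Finset.mem_insert, Finset.mem_Icc]
    omega

/-- Let `a : ℤ → ℂ` be even and let `c n = ∑_{k=-n+1}^{n} a k` for `n > 0`,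
`c 0 = 0`, `c (-n) = -c n`.  With `S` the `N × N` lower shift matrix,
`(I - S)(T_N(c) + H_N(c)) = (I + S)(T_N(a) + H_N(a))`. -/
theorem statement9 (a : ℤ → ℂ) (ha : ∀ n : ℤ, a (-n) = a n)
    (c : ℤ → ℂ)
    (hc : ∀ n : ℤ, 0 < n → c n = ∑ k ∈ Finset.Icc (-n + 1) n, a k)
    (hc0 : c 0 = 0)
    (hcneg : ∀ n : ℤ, 0 < n → c (-n) = -c n)
    (N : ℕ)
    (S : Matrix (Fin N) (Fin N) ℂ)
    (hS : ∀ j k : Fin N, S j k = if (j : ℕ) = (k : ℕ) + 1 then 1 else 0) :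
    (1 - S) *
        ((Matrix.of fun j k : Fin N => c ((j : ℤ) - (k : ℤ))) +
          (Matrix.of fun j k : Fin N => c ((j : ℤ) + (k : ℤ) + 1)))
      = (1 + S) *
        ((Matrix.of fun j k : Fin N => a ((j : ℤ) - (k : ℤ))) +
          (Matrix.of fun j k : Fin N => a ((j : ℤ) + (k : ℤ) + 1))) := by
  have hodd : ∀ n : ℤ, c (-n) = -c n := by
    intro n
    rcases lt_trichotomy n 0 with hn | rfl | hn
    · have := hcneg (-n) (by omega)
      rw [neg_neg] at this
      rw [this, neg_neg]
    · simp [hc0]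
    · exact hcneg n hn
  have hnonneg : ∀ n : ℤ, 0 ≤ n → c (n + 1) - c n = a (n + 1) + a n := by
    intro n hn
    have hcn : c n = ∑ k ∈ Finset.Icc (-n + 1) n, a k := by
      rcases hn.eq_or_lt with rfl | hn
      · simp [hc0]
      · exact hc n hn
    rw [hc (n + 1) (by omega), hcn, sum_Icc_neg_succ_sub a hn, ha]
    ring
  have hdiff : ∀ n : ℤ, c (n + 1) - c n = a (n + 1) + a n := by
    intro n
    rcases le_or_gt 0 n with hn | hn
    · exact hnonneg n hn
    · have h := hnonneg (-(n + 1)) (by omega)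
      rw [show -(n + 1) + 1 = -n by ring, hodd, hodd, ha, ha] at h
      linear_combination h
  ext j k
  simp only [sub_mul, add_mul, one_mul]
  rw [Matrix.sub_apply, Matrix.add_apply _ (S * _)]
  rcases Nat.eq_zero_or_eq_succ_pred (j : ℕ) with hj | hj
  · rw [shift_mul_apply_zero hS _ hj, shift_mul_apply_zero hS _ hj]
    simp only [Matrix.add_apply, Matrix.of_apply, hj, Nat.cast_zero, zero_sub, zero_add, hodd, ha]
    linear_combination hdiff k
  · obtain ⟨i, hi⟩ : ∃ i : Fin N, (j : ℕ) = (i : ℕ) + 1 :=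
      ⟨⟨(j : ℕ).pred, by have := j.isLt; omega⟩, hj⟩
    rw [shift_mul_apply_succ hS _ hi, shift_mul_apply_succ hS _ hi]
    simp only [Matrix.add_apply, Matrix.of_apply, hi, Nat.cast_add, Nat.cast_one]
    have h₁ := hdiff ((i : ℤ) - k)
    have h₂ := hdiff ((i : ℤ) + k + 1)
    rw [show (i : ℤ) - k + 1 = i + 1 - k by ring] at h₁
    rw [show (i : ℤ) + k + 1 + 1 = i + 1 + k + 1 by ring] at h₂
    linear_combination h₁ + h₂
end

section
/- Let c : ℤ → ℂ be a sequence with c_{-n} = -c_n for all n ∈ ℤ. For n ≥ 1 define b_n = Σ_{k=0}^{⌊n/2⌋} (C(n-1,k) - C(n-1,k-1))·c_{n-2k}, where C(n-1,-1) = 0. For N ≥ 1 let B_N = (b_{j+k+1})_{j,k=0}^{N-1} and C_{2N} = (c_{j-k})_{j,k=0}^{2N-1}. Then det C_{2N} = (det B_N)². -/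
open Finset

/-- The operator `F ↦ (n ↦ F (n + 1) + F (n - 1))` on two-sided sequences. -/
def neighborSum : Module.End ℂ (ℤ → ℂ) :=
  LinearMap.funLeft ℂ ℂ (fun n : ℤ => n + 1) + LinearMap.funLeft ℂ ℂ (fun n : ℤ => n - 1)

theorem neighborSum_apply (F : ℤ → ℂ) (n : ℤ) :
    neighborSum F n = F (n + 1) + F (n - 1) := rfl

theorem neighborSum_pow_apply (j : ℕ) (F : ℤ → ℂ) (n : ℤ) :
    (neighborSum ^ j) F n = ∑ m ∈ range (j + 1), (j.choose m : ℂ) * F (n + j - 2 * m) := by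
  induction j generalizing n with
  | zero => simp
  | succ j ih =>
    rw [pow_succ', Module.End.mul_apply, neighborSum_apply, ih, ih,
      sum_range_succ' _ (j + 1), sum_range_succ' _ j]
    have h : ∑ m ∈ range (j + 1), ((j + 1).choose (m + 1) : ℂ) *
          F (n + ((j + 1 : ℕ) : ℤ) - 2 * ((m + 1 : ℕ) : ℤ)) =
        (∑ m ∈ range (j + 1), (j.choose m : ℂ) * F (n - 1 + j - 2 * m)) +
        ∑ m ∈ range j, (j.choose (m + 1) : ℂ) * F (n + 1 + j - 2 * ((m + 1 : ℕ) : ℤ)) := by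
      have h' : ∑ m ∈ range j, (j.choose (m + 1) : ℂ) * F (n + 1 + j - 2 * ((m + 1 : ℕ) : ℤ)) =
          ∑ m ∈ range (j + 1),
            (j.choose (m + 1) : ℂ) * F (n + 1 + j - 2 * ((m + 1 : ℕ) : ℤ)) := by
        simp [sum_range_succ]
      rw [h', ← sum_add_distrib]
      refine sum_congr rfl fun m _ => ?_
      rw [Nat.choose_succ_succ, Nat.cast_add, add_mul]
      congr 3 <;> push_cast <;> ring
    rw [h]
    have h0 : n + 1 + (j : ℤ) - 2 * ((0 : ℕ) : ℤ) =
        n + ((j + 1 : ℕ) : ℤ) - 2 * ((0 : ℕ) : ℤ) := by push_cast; ring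
    rw [h0]
    simp only [Nat.choose_zero_right]
    ring

theorem neighborSum_pow_neg {c : ℤ → ℂ} (hc : ∀ n : ℤ, c (-n) = -c n) (j : ℕ) (n : ℤ) :
    (neighborSum ^ j) c (-n) = -(neighborSum ^ j) c n := by
  induction j generalizing n with
  | zero => simpa using hc n
  | succ j ih =>
    rw [pow_succ', Module.End.mul_apply, neighborSum_apply, neighborSum_apply,
      show -n + 1 = -(n - 1) by ring, show -n - 1 = -(n + 1) by ring, ih, ih]
    ring

theorem sum_ballot_eq_neighborSum_pow {c : ℤ → ℂ} (hc : ∀ n : ℤ, c (-n) = -c n) (n : ℕ) :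
    ∑ k ∈ range ((n + 1) / 2 + 1),
        ((n.choose k : ℂ) - (if k = 0 then 0 else (n.choose (k - 1) : ℂ))) *
          c (((n + 1 : ℕ) : ℤ) - 2 * k) = (neighborSum ^ n) c 1 := by
  have hc0 : c 0 = 0 := by
    have := hc 0
    rw [neg_zero] at this
    exact self_eq_neg.mp this
  set q := (n + 1) / 2 with hq
  have hlow : ∀ k : ℕ, k < q → (n.choose k : ℂ) * c (((n + 1 : ℕ) : ℤ) - 2 * (k + 1 : ℕ)) =
      -((n.choose (n - k) : ℂ) * c (1 + n - 2 * ((n - k : ℕ) : ℤ))) := by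
    intro k hk
    have hk' : k ≤ n := by omega
    rw [Nat.choose_symm hk', ← mul_neg, ← hc]
    congr 2
    push_cast [hk']
    ring
  simp only [sub_mul, sum_sub_distrib]
  rw [sum_range_succ' (fun k : ℕ => (if k = 0 then (0 : ℂ) else (n.choose (k - 1) : ℂ)) *
          c (((n + 1 : ℕ) : ℤ) - 2 * k)) q]
  simp only [Nat.add_eq_zero_iff, one_ne_zero, and_false, if_false, if_true, zero_mul, add_zero,
    Nat.add_sub_cancel]
  rw [sum_congr rfl fun k hk => hlow k (mem_range.mp hk), sum_neg_distrib, sub_neg_eq_add,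
    neighborSum_pow_apply]
  have hsplit := sum_range_add_sum_Ico (fun m : ℕ => (n.choose m : ℂ) * c (1 + n - 2 * m))
    (show n + 1 - q ≤ n + 1 by omega)
  have href := sum_Ico_reflect (fun m : ℕ => (n.choose m : ℂ) * c (1 + n - 2 * m)) 0
    (show q ≤ n + 1 by omega)
  rw [← range_eq_Ico, Nat.sub_zero] at href
  rw [← hsplit, ← href]
  congr 1
  · rcases Nat.even_or_odd' n with ⟨t, ht | ht⟩
    · rw [show n + 1 - q = q + 1 by omega]
      refine sum_congr rfl fun m _ => ?_
      push_cast; ring_nf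
    · rw [show n + 1 - q = q by omega, sum_range_succ,
        show ((n + 1 : ℕ) : ℤ) - 2 * (q : ℤ) = 0 by omega, hc0, mul_zero, add_zero]
      refine sum_congr rfl fun m _ => ?_
      push_cast; ring_nf

theorem det_eq_one_of_injective_level {ι R : Type*} [Fintype ι] [DecidableEq ι] [CommRing R]
    (M : Matrix ι ι R) (f : ι → ℕ) (hf : Function.Injective f)
    (hM : ∀ i j, f i < f j → M i j = 0) (hd : ∀ i, M i i = 1) : M.det = 1 := by
  let := LinearOrder.lift' f hf
  have h := Matrix.det_of_isLowerTriangular M fun i j hij => hM i j hij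
  simp only [hd, prod_const_one] at h
  convert h

theorem det_fromBlocks_zero_neg_zero {n R : Type*} [Fintype n] [DecidableEq n] [CommRing R]
    (B : Matrix n n R) : (Matrix.fromBlocks 0 B (-B) 0).det = B.det ^ 2 := by
  have h : Matrix.fromBlocks 0 B (-B) 0 =
      Matrix.fromBlocks B 0 0 B * (Matrix.fromBlocks 1 1 0 1 * Matrix.fromBlocks 1 0 (-1) 1 *
        Matrix.fromBlocks 1 1 0 1) := by
    simp [Matrix.fromBlocks_multiply]
  rw [h]
  simp [Matrix.det_mul, sq]

/-- Exponents of the Laurent monomials, centred so that `inl j` and `inr j` are mirror images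
under `z ↦ z⁻¹` up to a shift by one. -/
def mirrorExponent {N : ℕ} : Fin N ⊕ Fin N → ℤ :=
  Sum.elim (fun j => (j : ℤ) + 1) (fun j => -(j : ℤ))

/-- The power of `z + z⁻¹` in the new basis vector. -/
def basisDegree {N : ℕ} : Fin N ⊕ Fin N → ℕ := Sum.elim (fun j => j) (fun j => j)

/-- The power of `z` multiplying `(z + z⁻¹) ^ j` in the new basis vector. -/
def basisShift {N : ℕ} : Fin N ⊕ Fin N → ℤ := Sum.elim (fun _ => 1) (fun _ => 0)

/-- The coordinates of `z * (z + z⁻¹) ^ j` and `(z + z⁻¹) ^ j` in the monomial basis. -/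
def basisChange (N : ℕ) : Matrix (Fin N ⊕ Fin N) (Fin N ⊕ Fin N) ℂ :=
  Matrix.of fun a x => ∑ m ∈ range (basisDegree a + 1), ((basisDegree a).choose m : ℂ) *
    if mirrorExponent x = basisShift a + basisDegree a - 2 * m then 1 else 0

/-- The Toeplitz matrix of `c`, indexed by the exponents `mirrorExponent`. -/
def mirrorToeplitz (N : ℕ) (c : ℤ → ℂ) : Matrix (Fin N ⊕ Fin N) (Fin N ⊕ Fin N) ℂ :=
  Matrix.of fun x y => c (mirrorExponent x - mirrorExponent y)

theorem mirrorExponent_injective {N : ℕ} :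
    Function.Injective (mirrorExponent : Fin N ⊕ Fin N → ℤ) := by
  rintro (i | i) (j | j) h <;> simp only [mirrorExponent, Sum.elim_inl, Sum.elim_inr] at h
  · exact congrArg _ (Fin.ext (by omega))
  · omega
  · omega
  · exact congrArg _ (Fin.ext (by omega))

theorem exists_mirrorExponent_eq {N : ℕ} {n : ℤ} (h₁ : -(N : ℤ) < n) (h₂ : n ≤ N) :
    ∃ x : Fin N ⊕ Fin N, mirrorExponent x = n := by
  rcases le_or_gt n 0 with h | h
  · exact ⟨.inr ⟨(-n).toNat, by omega⟩, by simp [mirrorExponent]; omega⟩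
  · exact ⟨.inl ⟨(n - 1).toNat, by omega⟩, by simp [mirrorExponent]; omega⟩

theorem det_basisChange (N : ℕ) : (basisChange N).det = 1 := by
  refine det_eq_one_of_injective_level _
    (Sum.elim (fun j => 2 * (j : ℕ) + 1) (fun j => 2 * (j : ℕ))) ?_ ?_ ?_
  · rintro (i | i) (j | j) h <;> simp only [Sum.elim_inl, Sum.elim_inr] at h
    · exact congrArg _ (Fin.ext (by omega))
    · omega
    · omega
    · exact congrArg _ (Fin.ext (by omega))
  · intro a x h
    rw [basisChange, Matrix.of_apply]
    refine sum_eq_zero fun m hm => ?_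
    rw [if_neg, mul_zero]
    rw [mem_range] at hm
    rcases a with i | i <;> rcases x with j | j <;>
      simp only [Sum.elim_inl, Sum.elim_inr, mirrorExponent, basisDegree, basisShift] at h hm ⊢ <;>
      omega
  · rintro (i | i) <;> rw [basisChange, Matrix.of_apply]
    · rw [sum_eq_single_of_mem 0 (by simp)]
      · simp [mirrorExponent, basisDegree, basisShift, add_comm]
      · intro m _ hm
        rw [if_neg, mul_zero]
        simp only [mirrorExponent, basisDegree, basisShift, Sum.elim_inl]
        omega
    · rw [sum_eq_single_of_mem (i : ℕ) (by simp [basisDegree])]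
      · rw [if_pos] <;> simp only [mirrorExponent, basisDegree, basisShift, Sum.elim_inr]
        · simp
        · ring
      · intro m _ hm
        rw [if_neg, mul_zero]
        simp only [mirrorExponent, basisDegree, basisShift, Sum.elim_inr]
        omega

theorem sum_basisChange_mul {N : ℕ} (a : Fin N ⊕ Fin N) (F : ℤ → ℂ) :
    ∑ x, basisChange N a x * F (mirrorExponent x) = (neighborSum ^ basisDegree a) F
      (basisShift a) := by
  rw [neighborSum_pow_apply]
  simp only [basisChange, Matrix.of_apply, sum_mul]
  rw [sum_comm]
  refine sum_congr rfl fun m hm => ?_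
  rw [mem_range] at hm
  obtain ⟨x, hx⟩ : ∃ x : Fin N ⊕ Fin N,
      mirrorExponent x = basisShift a + basisDegree a - 2 * m := by
    apply exists_mirrorExponent_eq <;> rcases a with i | i <;>
      simp only [basisDegree, basisShift, Sum.elim_inl, Sum.elim_inr] at hm ⊢ <;> omega
  rw [sum_eq_single_of_mem x (mem_univ x), if_pos hx, mul_one, hx]
  intro y _ hy
  rw [if_neg fun h => hy (mirrorExponent_injective (h.trans hx.symm)), mul_zero, zero_mul]

theorem neighborSum_pow_comp_const_sub (j : ℕ) (F : ℤ → ℂ) (d n : ℤ) :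
    (neighborSum ^ j) (fun t => F (d - t)) n = (neighborSum ^ j) F (d - n) := by
  induction j generalizing n with
  | zero => rfl
  | succ j ih =>
    rw [pow_succ', Module.End.mul_apply, Module.End.mul_apply, neighborSum_apply,
      neighborSum_apply, ih, ih, show d - (n + 1) = d - n - 1 by ring,
      show d - (n - 1) = d - n + 1 by ring, add_comm]

theorem neighborSum_pow_comp_sub_const (j : ℕ) (F : ℤ → ℂ) (d n : ℤ) :
    (neighborSum ^ j) (fun t => F (t - d)) n = (neighborSum ^ j) F (n - d) := by
  simp only [neighborSum_pow_apply]
  refine sum_congr rfl fun m _ => ?_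
  congr 2
  ring

theorem basisChange_mul_mul_transpose_apply {N : ℕ} (c : ℤ → ℂ) (a b : Fin N ⊕ Fin N) :
    (basisChange N * mirrorToeplitz N c *
      (basisChange N).transpose) a b =
      (neighborSum ^ (basisDegree a + basisDegree b)) c (basisShift a - basisShift b) := by
  have h (y : Fin N ⊕ Fin N) :
      (basisChange N * mirrorToeplitz N c) a y =
        (neighborSum ^ basisDegree a) c (basisShift a - mirrorExponent y) := by
    rw [← neighborSum_pow_comp_sub_const, ← sum_basisChange_mul]
    rfl
  rw [Matrix.mul_apply, add_comm, pow_add, Module.End.mul_apply, ← neighborSum_pow_comp_const_sub,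
    ← sum_basisChange_mul]
  exact sum_congr rfl fun y _ => by rw [h, Matrix.transpose_apply, mul_comm]

/-- The equivalence placing the monomial of exponent `n` at index `n + N - 1`. -/
noncomputable def mirrorEquiv (N : ℕ) : Fin N ⊕ Fin N ≃ Fin (2 * N) :=
  Equiv.ofBijective
    (Sum.elim (fun j => ⟨N + j, by omega⟩) (fun j => ⟨N - 1 - j, by omega⟩)) <| by
    rw [Fintype.bijective_iff_injective_and_card]
    refine ⟨?_, by simp [two_mul]⟩
    rintro (i | i) (j | j) h <;>
      simp only [Sum.elim_inl, Sum.elim_inr, Fin.mk.injEq] at h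
    · exact congrArg _ (Fin.ext (by omega))
    · omega
    · omega
    · exact congrArg _ (Fin.ext (by omega))

theorem coe_mirrorEquiv {N : ℕ} (x : Fin N ⊕ Fin N) :
    ((mirrorEquiv N x : ℕ) : ℤ) = mirrorExponent x + N - 1 := by
  rcases x with i | i <;> simp [mirrorEquiv, mirrorExponent] <;> omega

/-- Let `c : ℤ → ℂ` satisfy `c (-n) = -c n`, and for `n ≥ 1` define
`b n = ∑_{k=0}^{⌊n/2⌋} (C(n-1,k) - C(n-1,k-1)) c (n-2k)` with `C(n-1,-1) = 0`.
Then `det C_{2N} = (det B_N)²` where `B_N = (b (j+k+1))` and `C_{2N} = (c (j-k))`. -/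
theorem statement10 (c : ℤ → ℂ) (hc : ∀ n : ℤ, c (-n) = -c n)
    (b : ℕ → ℂ)
    (hb : ∀ n : ℕ, 1 ≤ n →
      b n = ∑ k ∈ Finset.range (n / 2 + 1),
        (((n - 1).choose k : ℂ) - (if k = 0 then 0 else ((n - 1).choose (k - 1) : ℂ))) *
          c ((n : ℤ) - 2 * k))
    (N : ℕ) (hN : 1 ≤ N) :
    Matrix.det (Matrix.of fun j k : Fin (2 * N) => c ((j : ℤ) - (k : ℤ)))
      = (Matrix.det (Matrix.of fun j k : Fin N => b ((j : ℕ) + (k : ℕ) + 1))) ^ 2 := by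
  have hbn (n : ℕ) : b (n + 1) = (neighborSum ^ n) c 1 := by
    rw [hb (n + 1) (by omega), ← sum_ballot_eq_neighborSum_pow hc]
    rfl
  have h0 (n : ℕ) : (neighborSum ^ n) c 0 = 0 := by
    have := neighborSum_pow_neg hc n 0
    rw [neg_zero] at this
    exact self_eq_neg.mp this
  rw [← Matrix.det_submatrix_equiv_self (mirrorEquiv N)]
  have hsub : (Matrix.of fun j k : Fin (2 * N) => c ((j : ℤ) - (k : ℤ))).submatrix
      (mirrorEquiv N) (mirrorEquiv N) =
      mirrorToeplitz N c := by
    ext x y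
    simp only [mirrorToeplitz, Matrix.submatrix_apply, Matrix.of_apply, coe_mirrorEquiv]
    congr 1
    ring
  have hblocks : basisChange N * mirrorToeplitz N c *
      (basisChange N).transpose =
      Matrix.fromBlocks 0 (Matrix.of fun j k : Fin N => b ((j : ℕ) + (k : ℕ) + 1))
        (-Matrix.of fun j k : Fin N => b ((j : ℕ) + (k : ℕ) + 1)) 0 := by
    ext a d
    rw [basisChange_mul_mul_transpose_apply]
    rcases a with i | i <;> rcases d with j | j <;>
      simp [basisDegree, basisShift, h0, hbn, neighborSum_pow_neg hc]
  rw [hsub, ← det_fromBlocks_zero_neg_zero, ← hblocks, Matrix.det_mul, Matrix.det_mul,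
    Matrix.det_transpose, det_basisChange, one_mul, mul_one]
end

section
/- Let a : ℤ → ℂ be a sequence with a_{-n} = a_n for all n ∈ ℤ, and define c : ℤ → ℂ by c_n = Σ_{k=-n+1}^{n} a_k for n > 0, c_0 = 0, c_{-n} = -c_n for n > 0. Then for every n ≥ 1: Σ_{k=0}^{⌊n/2⌋} (C(n-1,k) - C(n-1,k-1))·c_{n-2k} = Σ_{k=0}^{n-1} C(n-1,k)·(a_{2k+1-n} + a_{2k+2-n}), where C(n-1,-1) = 0. -/
open Finset

/-- A sum over `0, …, n` of a function symmetric under `k ↦ n - k` that vanishes at `n / 2` is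
twice the sum over its first half. -/
theorem sum_range_eq_two_mul_sum_half {R : Type*} [Semiring R] (f : ℕ → R) (n : ℕ)
    (hsymm : ∀ k ≤ n, f (n - k) = f k) (hmid : ∀ k, 2 * k = n → f k = 0) :
    ∑ k ∈ Finset.range (n + 1), f k = 2 * ∑ k ∈ Finset.range (n / 2 + 1), f k := by
  have hupper : ∑ k ∈ Finset.Ico (n / 2 + 1) (n + 1), f k = ∑ k ∈ Finset.range (n - n / 2), f k := by
    refine Finset.sum_nbij' (fun k => n - k) (fun k => n - k) ?_ ?_ ?_ ?_ ?_
    all_goals intro k hk; simp only [Finset.mem_Ico, Finset.mem_range] at hk ⊢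
    any_goals omega
    exact (hsymm k (by omega)).symm
  rw [← Finset.sum_range_add_sum_Ico f (by omega : n / 2 + 1 ≤ n + 1), hupper, two_mul]
  congr 1
  rcases Nat.even_or_odd' n with ⟨p, rfl | rfl⟩
  · rw [show 2 * p - 2 * p / 2 = p by omega, show 2 * p / 2 = p by omega, Finset.sum_range_succ,
      hmid p rfl, add_zero]
  · congr 2
    omega

/-- The antisymmetric partial sums of an even sequence have increments `a (j + 1) + a j`. -/
theorem symmetric_sum_add_one {a c : ℤ → ℂ} (ha : ∀ n : ℤ, a (-n) = a n)
    (hc : ∀ n : ℤ, 0 < n → c n = ∑ k ∈ Finset.Icc (-n + 1) n, a k)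
    (hc0 : c 0 = 0) (hcneg : ∀ n : ℤ, 0 < n → c (-n) = -c n) (j : ℤ) :
    c (j + 1) = c j + a (j + 1) + a j := by
  have hnonneg : ∀ i : ℤ, 0 ≤ i → c (i + 1) = c i + a (i + 1) + a i := by
    intro i hi
    have hci : c i = ∑ k ∈ Finset.Icc (-i + 1) i, a k := by
      rcases hi.eq_or_lt with rfl | hi
      · simp [hc0]
      · exact hc i hi
    have hIcc : Finset.Icc (-(i + 1) + 1) (i + 1) =
        insert (i + 1) (insert (-i) (Finset.Icc (-i + 1) i)) := by
      ext k
      simp only [Finset.mem_Icc, Finset.mem_insert]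
      omega
    rw [hc _ (by omega), hci, hIcc, Finset.sum_insert (by simp; omega),
      Finset.sum_insert (by simp), ha]
    ring
  have hodd : ∀ i : ℤ, 0 ≤ i → c (-i) = -c i := by
    intro i hi
    rcases hi.eq_or_lt with rfl | hi
    · simp [hc0]
    · exact hcneg i hi
  rcases le_or_gt 0 j with hj | hj
  · exact hnonneg j hj
  · have h := hnonneg (-(j + 1)) (by omega)
    have h₁ := hodd (-(j + 1)) (by omega)
    have h₂ := hodd (-j) (by omega)
    rw [show -(j + 1) + 1 = -j by ring, ha, ha] at h
    rw [neg_neg] at h₁ h₂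
    linear_combination h₁ - h₂ + h

/-- Let `a : ℤ → ℂ` be even and let `c n = ∑_{k=-n+1}^{n} a k` for `n > 0`,
`c 0 = 0`, `c (-n) = -c n`.  Then for every `n ≥ 1`:
`∑_{k=0}^{⌊n/2⌋} (C(n-1,k) - C(n-1,k-1)) c (n-2k)
   = ∑_{k=0}^{n-1} C(n-1,k) (a (2k+1-n) + a (2k+2-n))`, with `C(n-1,-1) = 0`. -/
theorem statement11 (a : ℤ → ℂ) (ha : ∀ n : ℤ, a (-n) = a n)
    (c : ℤ → ℂ)
    (hc : ∀ n : ℤ, 0 < n → c n = ∑ k ∈ Finset.Icc (-n + 1) n, a k)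
    (hc0 : c 0 = 0)
    (hcneg : ∀ n : ℤ, 0 < n → c (-n) = -c n)
    (n : ℕ) (hn : 1 ≤ n) :
    ∑ k ∈ Finset.range (n / 2 + 1),
        (((n - 1).choose k : ℂ) - (if k = 0 then 0 else ((n - 1).choose (k - 1) : ℂ))) *
          c ((n : ℤ) - 2 * k)
      = ∑ k ∈ Finset.range n,
          ((n - 1).choose k : ℂ) * (a (2 * k + 1 - (n : ℤ)) + a (2 * k + 2 - (n : ℤ))) := by
  obtain ⟨m, rfl⟩ : ∃ m, n = m + 1 := ⟨n - 1, by omega⟩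
  simp only [Nat.add_sub_cancel]
  have hstep := symmetric_sum_add_one ha hc hc0 hcneg
  have hodd : ∀ i : ℤ, c (-i) = -c i := by
    intro i
    rcases lt_trichotomy i 0 with hi | rfl | hi
    · rw [← neg_neg (c (-i)), ← hcneg (-i) (by omega), neg_neg]
    · simp [hc0]
    · exact hcneg i hi
  set f : ℕ → ℂ := fun k =>
    ((m.choose k : ℂ) - (if k = 0 then 0 else (m.choose (k - 1) : ℂ))) *
      c (((m + 1 : ℕ) : ℤ) - 2 * k) with hf
  have hhalf := sum_range_eq_two_mul_sum_half f (m + 1)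
    (by
      intro k hk
      have hcoeff : ∀ i j : ℕ, i + j = m + 1 →
          (m.choose i : ℂ) = if j = 0 then 0 else (m.choose (j - 1) : ℂ) := by
        intro i j hij
        split_ifs with hj
        · rw [Nat.choose_eq_zero_of_lt (by omega), Nat.cast_zero]
        · rw [Nat.choose_symm_of_eq_add (by omega : m = i + (j - 1))]
      simp only [hf]
      rw [hcoeff (m + 1 - k) k (by omega), ← hcoeff k (m + 1 - k) (by omega),
        show ((m + 1 : ℕ) : ℤ) - 2 * ((m + 1 - k : ℕ) : ℤ) = -(((m + 1 : ℕ) : ℤ) - 2 * k) by omega,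
        hodd]
      ring)
    (by
      intro k hk
      simp only [hf]
      rw [show ((m + 1 : ℕ) : ℤ) - 2 * k = 0 by omega, hc0, mul_zero])
  have habel : ∑ k ∈ Finset.range (m + 1 + 1), f k = ∑ k ∈ Finset.range (m + 1),
      (m.choose k : ℂ) * (c (((m + 1 : ℕ) : ℤ) - 2 * k) - c (((m + 1 : ℕ) : ℤ) - 2 * k - 2)) := by
    simp only [hf, sub_mul, mul_sub, Finset.sum_sub_distrib]
    congr 1
    · rw [Finset.sum_range_succ, Nat.choose_succ_self]
      simp
    · rw [Finset.sum_range_succ']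
      simp only [Nat.add_eq_zero_iff, one_ne_zero, and_false, if_false, if_true, zero_mul, add_zero,
        Nat.add_sub_cancel]
      refine Finset.sum_congr rfl fun k _ => ?_
      congr 2
      push_cast
      ring
  have hdiff : ∀ k : ℕ, c (((m + 1 : ℕ) : ℤ) - 2 * k) - c (((m + 1 : ℕ) : ℤ) - 2 * k - 2) =
      a (((m + 1 : ℕ) : ℤ) - 2 * k) + 2 * a (2 * k + 1 - ((m + 1 : ℕ) : ℤ)) +
        a (2 * k + 2 - ((m + 1 : ℕ) : ℤ)) := by
    intro k
    rw [← ha (2 * k + 1 - ((m + 1 : ℕ) : ℤ)), ← ha (2 * k + 2 - ((m + 1 : ℕ) : ℤ))]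
    generalize ((m + 1 : ℕ) : ℤ) = N
    have h₁ := hstep (N - 2 * k - 1)
    have h₂ := hstep (N - 2 * k - 2)
    rw [show N - 2 * k - 1 + 1 = N - 2 * k by ring] at h₁
    rw [show N - 2 * k - 2 + 1 = N - 2 * k - 1 by ring] at h₂
    rw [show -(2 * (k : ℤ) + 1 - N) = N - 2 * k - 1 by ring,
      show -(2 * (k : ℤ) + 2 - N) = N - 2 * k - 2 by ring]
    linear_combination h₁ + h₂
  have hreflect : ∑ k ∈ Finset.range (m + 1), (m.choose k : ℂ) * a (((m + 1 : ℕ) : ℤ) - 2 * k) =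
      ∑ k ∈ Finset.range (m + 1), (m.choose k : ℂ) * a (2 * k + 2 - ((m + 1 : ℕ) : ℤ)) := by
    rw [← Finset.sum_range_reflect]
    refine Finset.sum_congr rfl fun k hk => ?_
    have hkm : k ≤ m := Nat.lt_succ_iff.mp (Finset.mem_range.mp hk)
    rw [Nat.add_sub_cancel, Nat.choose_symm hkm]
    congr 2
    omega
  simp only [hdiff, mul_add, Finset.sum_add_distrib, hreflect, mul_left_comm _ (2 : ℂ),
    ← Finset.mul_sum] at habel
  simp only [mul_add, Finset.sum_add_distrib]
  linear_combination (habel - hhalf) / 2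
end

section
/- Let a : ℤ → ℂ be a sequence with a_{2n+1} = 0 for all n ∈ ℤ (corresponding to a symbol with a(-t) = a(t)), and define d : ℤ → ℂ by d_n = a_{2n} (corresponding to d(e^{iθ}) = a(e^{iθ/2})). Then for every N ≥ 1, det T_{2N}(a) = (det T_N(d))². -/
/-- Grouping the indices of a Toeplitz matrix by parity makes it block diagonal when all odd
coefficients vanish. -/
theorem submatrix_eq_blockDiagonal_of_odd_eq_zero {R : Type*} [Zero R] (a : ℤ → R)
    (hodd : ∀ n : ℤ, a (2 * n + 1) = 0) (d : ℤ → R) (hd : ∀ n : ℤ, d n = a (2 * n)) (N : ℕ) :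
    (Matrix.of fun j k : Fin (2 * N) => a ((j : ℤ) - (k : ℤ))).submatrix
        (finProdFinEquiv.trans (finCongr (Nat.mul_comm N 2)))
        (finProdFinEquiv.trans (finCongr (Nat.mul_comm N 2)))
      = Matrix.blockDiagonal fun _ : Fin 2 =>
          Matrix.of fun j k : Fin N => d ((j : ℤ) - (k : ℤ)) := by
  ext ⟨j, p⟩ ⟨k, q⟩
  simp only [Matrix.submatrix_apply, Matrix.of_apply, Matrix.blockDiagonal_apply,
    Equiv.trans_apply, finCongr_apply, Fin.val_cast, finProdFinEquiv_apply_val]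
  split_ifs with h
  · subst h
    rw [hd]
    congr 1
    push_cast
    ring
  · have hpq : (p : ℕ) ≠ q := fun e => h (Fin.ext e)
    obtain ⟨n, hn⟩ : ∃ n : ℤ,
        ((p + 2 * j : ℕ) : ℤ) - ((q + 2 * k : ℕ) : ℤ) = 2 * n + 1 :=
      ⟨(((p + 2 * j : ℕ) : ℤ) - ((q + 2 * k : ℕ) : ℤ)) / 2, by omega⟩
    rw [hn, hodd]


/-- Let `a : ℤ → ℂ` satisfy `a (2n+1) = 0` for all `n` (so the symbol
satisfies `a(-t) = a(t)`), and set `d n = a (2n)`.  Then for every `N ≥ 1`,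
`det T_{2N}(a) = (det T_N(d))²`. -/
theorem statement14 (a : ℤ → ℂ) (hodd : ∀ n : ℤ, a (2 * n + 1) = 0)
    (d : ℤ → ℂ) (hd : ∀ n : ℤ, d n = a (2 * n))
    (N : ℕ) (hN : 1 ≤ N) :
    Matrix.det (Matrix.of fun j k : Fin (2 * N) => a ((j : ℤ) - (k : ℤ)))
      = (Matrix.det (Matrix.of fun j k : Fin N => d ((j : ℤ) - (k : ℤ)))) ^ 2 := by
  rw [← Matrix.det_submatrix_equiv_self (finProdFinEquiv.trans (finCongr (Nat.mul_comm N 2))),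
    submatrix_eq_blockDiagonal_of_odd_eq_zero a hodd d hd N, Matrix.det_blockDiagonal,
    Finset.prod_const, Finset.card_univ, Fintype.card_fin]
end

section
/- Let c : ℤ → ℂ be a sequence with c_{2n} = 0 for all n ∈ ℤ (this holds for the Fourier coefficients of c(e^{iθ}) = i·sign(θ)·a(e^{iθ}) when a(-t) = a(t)). Then for every N ≥ 1: det(c_{j-k})_{j,k=0}^{2N-1} = (-1)^N · det(c_{2(j-k)+1})_{j,k=0}^{N-1} · det(c_{2(j-k)-1})_{j,k=0}^{N-1}. Equivalently, det T_{2N}(c) = det T_N(d_1)·det T_N(d_2), where (d_1)_n = c_{2n+1} and (d_2)_n = -c_{2n-1}. -/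
/-- The equivalence sending the left copy of `j` to `2 * j` and the right copy to `2 * j + 1`. -/
noncomputable def parityEquiv (N : ℕ) : Fin N ⊕ Fin N ≃ Fin (2 * N) :=
  Equiv.ofBijective
    (Sum.elim (fun j => ⟨2 * j, by omega⟩) (fun j => ⟨2 * j + 1, by omega⟩)) <| by
    rw [Fintype.bijective_iff_injective_and_card]
    refine ⟨?_, by simp [two_mul]⟩
    rintro (a | a) (b | b) h <;> simp [Fin.ext_iff] at h ⊢ <;> omega

theorem parityEquiv_inl_val {N : ℕ} (j : Fin N) : (parityEquiv N (Sum.inl j) : ℕ) = 2 * j := rfl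

theorem parityEquiv_inr_val {N : ℕ} (j : Fin N) :
    (parityEquiv N (Sum.inr j) : ℕ) = 2 * j + 1 := rfl

theorem Matrix.det_fromBlocks_zero₁₁_zero₂₂ {n R : Type*} [Fintype n] [DecidableEq n]
    [CommRing R] (B C : Matrix n n R) :
    (Matrix.fromBlocks 0 B C 0).det = (-1) ^ Fintype.card n * C.det * B.det := by
  have hswap : (Matrix.fromBlocks 0 1 1 0 : Matrix (n ⊕ n) (n ⊕ n) R).det =
      (-1) ^ Fintype.card n := by
    have h : (Matrix.fromBlocks 0 1 1 0 : Matrix (n ⊕ n) (n ⊕ n) R) *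
        Matrix.fromBlocks 1 0 1 1 = Matrix.fromBlocks 1 1 1 0 := by
      simp [Matrix.fromBlocks_multiply]
    have h' := congrArg Matrix.det h
    simpa [Matrix.det_mul, Matrix.det_fromBlocks_one₁₁, Matrix.det_neg] using h'
  have h : Matrix.fromBlocks 0 B C 0 =
      Matrix.fromBlocks B 0 0 C * Matrix.fromBlocks 0 1 1 0 := by
    simp [Matrix.fromBlocks_multiply]
  rw [h, Matrix.det_mul, Matrix.det_fromBlocks_zero₂₁, hswap]
  ring

/-- Let `c : ℤ → ℂ` satisfy `c (2n) = 0` for all `n`.  Then for every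
`N ≥ 1`:
`det (c (j-k))_{j,k=0}^{2N-1}
   = (-1)^N det (c (2(j-k)+1))_{j,k=0}^{N-1} ⬝ det (c (2(j-k)-1))_{j,k=0}^{N-1}`,
i.e. `det T_{2N}(c) = det T_N(d₁) det T_N(d₂)` with `(d₁) n = c (2n+1)`,
`(d₂) n = -c (2n-1)`. -/
theorem statement15 (c : ℤ → ℂ) (heven : ∀ n : ℤ, c (2 * n) = 0)
    (N : ℕ) (hN : 1 ≤ N) :
    Matrix.det (Matrix.of fun j k : Fin (2 * N) => c ((j : ℤ) - (k : ℤ)))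
      = (-1 : ℂ) ^ N *
          Matrix.det (Matrix.of fun j k : Fin N => c (2 * ((j : ℤ) - (k : ℤ)) + 1)) *
          Matrix.det (Matrix.of fun j k : Fin N => c (2 * ((j : ℤ) - (k : ℤ)) - 1)) := by
  have h : (Matrix.of fun j k : Fin (2 * N) => c ((j : ℤ) - (k : ℤ))).submatrix
      (parityEquiv N) (parityEquiv N) =
      Matrix.fromBlocks 0
        (Matrix.of fun j k : Fin N => c (2 * ((j : ℤ) - (k : ℤ)) - 1))
        (Matrix.of fun j k : Fin N => c (2 * ((j : ℤ) - (k : ℤ)) + 1)) 0 := by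
    ext (j | j) (k | k) <;>
      simp only [Matrix.submatrix_apply, Matrix.of_apply, Matrix.fromBlocks_apply₁₁,
        Matrix.fromBlocks_apply₁₂, Matrix.fromBlocks_apply₂₁, Matrix.fromBlocks_apply₂₂,
        Matrix.zero_apply, parityEquiv_inl_val, parityEquiv_inr_val]
    · rw [← heven (j - k)]
      congr 1
      push_cast
      ring
    · congr 1
      push_cast
      ring
    · congr 1
      push_cast
      ring
    · rw [← heven (j - k)]
      congr 1
      push_cast
      ring
  rw [← Matrix.det_submatrix_equiv_self (parityEquiv N), h,
    Matrix.det_fromBlocks_zero₁₁_zero₂₂, Fintype.card_fin]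
end
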